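/- Let 𝔤 be a finite-dimensional Lie algebra over k. Then there exists a finite-dimensional Lie algebra 𝔤' over k such that (S𝔤')^{𝔤'}_si = (S𝔤')^{𝔤'} (i.e., S𝔤' contains no proper semi-invariants), such that (S𝔤)^𝔤_si and (S𝔤')^{𝔤'}_si are isomorphic as graded k-algebras, and such that c(𝔤') = c(𝔤). -/

import Mathlib

open Module MvPolynomial

namespace Paper

variable (k : Type) [Field k]

/-- The stabilizer `𝔤_x` of `x ∈ 𝔤*`. -/
def stab (L : Type) [LieRing L] [LieAlgebra k L] (x : Module.Dual k L) : Submodule k L where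
  carrier := {v | ∀ w, x ⁅v, w⁆ = 0}
  add_mem' := by intro a b ha hb w; simp [add_lie, ha w, hb w]
  zero_mem' := by intro w; simp
  smul_mem' := by intro c a ha w; simp [smul_lie, ha w]

/-- The index `i(𝔤)` of a Lie algebra: the minimal dimension of a stabilizer. -/
noncomputable def lieIndex (L : Type) [LieRing L] [LieAlgebra k L] : ℕ :=
  ⨅ x : Module.Dual k L, finrank k (stab k L x)

/-- The set of non-regular elements `𝔤* \ 𝔤*_reg`. -/
def nonReg (L : Type) [LieRing L] [LieAlgebra k L] : Set (Module.Dual k L) :=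
  {x | finrank k (stab k L x) ≠ lieIndex k L}

variable {k}
variable {L : Type} [LieRing L] [LieAlgebra k L]

/-- The element of the polynomial model of the symmetric algebra `S(V)`
(w.r.t. the basis `bV`) corresponding to a vector `v ∈ V`. -/
noncomputable def rep {ι V : Type} [Fintype ι] [AddCommGroup V] [Module k V]
    (bV : Basis ι k V) (v : V) : MvPolynomial ι k :=
  ∑ i, MvPolynomial.C (bV.repr v i) * MvPolynomial.X i

/-- The action of `v ∈ 𝔤` on the symmetric algebra `S(V)` of a `𝔤`-module `V`,
as a derivation (extending `w ↦ v · w = ⁅v, w⁆`). -/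
noncomputable def actDer {ι V : Type} [Fintype ι] [AddCommGroup V] [Module k V]
    [LieRingModule L V] (bV : Basis ι k V) (v : L) :
    Derivation k (MvPolynomial ι k) (MvPolynomial ι k) :=
  MvPolynomial.mkDerivation k fun i => rep bV ⁅v, bV i⁆

/-- Semi-invariants in `S(V)` for the action of a (sub)space `A` mapping to `𝔤` via `em`:
nonzero `f` with `a · f = χ(a) • f` for some weight `χ ∈ A*`. -/
noncomputable def semiInvSet {ι V A : Type} [Fintype ι] [AddCommGroup V] [Module k V]
    [LieRingModule L V] [AddCommGroup A] [Module k A]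
    (bV : Basis ι k V) (em : A → L) : Set (MvPolynomial ι k) :=
  {f | f ≠ 0 ∧ ∃ χ : Module.Dual k A, ∀ a : A, actDer bV (em a) f = χ a • f}

/-- The semi-center: the subalgebra generated by all semi-invariants. -/
noncomputable def semiCenter {ι V A : Type} [Fintype ι] [AddCommGroup V] [Module k V]
    [LieRingModule L V] [AddCommGroup A] [Module k A]
    (bV : Basis ι k V) (em : A → L) : Subalgebra k (MvPolynomial ι k) :=
  Algebra.adjoin k (semiInvSet bV em)

/-- The subalgebra of invariants in `S(V)`. -/
noncomputable def invariants {ι V A : Type} [Fintype ι] [AddCommGroup V] [Module k V]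
    [LieRingModule L V] (bV : Basis ι k V) (em : A → L) : Subalgebra k (MvPolynomial ι k) where
  carrier := {f | ∀ a : A, actDer bV (em a) f = 0}
  mul_mem' := by intro f g hf hg a; simp [Derivation.leibniz, hf a, hg a]
  one_mem' := by intro a; simp
  add_mem' := by intro f g hf hg a; simp [hf a, hg a]
  zero_mem' := by intro a; simp
  algebraMap_mem' := by intro c a; simp

/-- The structure matrix `B = ([v_i, v_j])_{ij}` of `𝔤` w.r.t. a basis. -/
noncomputable def structMat {ι : Type} [Fintype ι] (b : Basis ι k L) :
    Matrix ι ι (MvPolynomial ι k) :=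
  Matrix.of fun i j => rep b ⁅b i, b j⁆

/-- The set of `s × s` minors of the structure matrix. -/
noncomputable def minorsSet {ι : Type} [Fintype ι] [DecidableEq ι] (b : Basis ι k L) (s : ℕ) :
    Set (MvPolynomial ι k) :=
  {p | ∃ f g : Fin s ↪ ι, p = ((structMat b).submatrix f g).det}

/-- `g` is a greatest common divisor of the set `A`. -/
def IsGcdOf {α : Type} [CommMonoidWithZero α] (g : α) (A : Set α) : Prop :=
  (∀ a ∈ A, g ∣ a) ∧ ∀ c, (∀ a ∈ A, c ∣ a) → c ∣ g

/-- The Pfaffian of an `n × n` matrix (`n = 2m` even), via the standard formula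
`pf(A) = (2^m m!)⁻¹ Σ_σ sgn(σ) Π_i A_{σ(2i) σ(2i+1)}` (valid in characteristic zero). -/
noncomputable def pfaffian {n : ℕ} {R : Type} [CommRing R] [Algebra ℚ R]
    (A : Matrix (Fin n) (Fin n) R) : R :=
  ((2 ^ (n / 2) * (n / 2).factorial : ℚ)⁻¹) •
    ∑ σ : Equiv.Perm (Fin n), (Equiv.Perm.sign σ : ℤ) •
      ∏ i : Fin (n / 2),
        A (σ ⟨2 * i.1, by have := i.2; omega⟩) (σ ⟨2 * i.1 + 1, by have := i.2; omega⟩)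

/-- The set of Pfaffians of the principal `s × s` minors of the structure matrix. -/
noncomputable def principalPfaffians {ι : Type} [Fintype ι] [DecidableEq ι] [CharZero k]
    (b : Basis ι k L) (s : ℕ) : Set (MvPolynomial ι k) :=
  {p | ∃ f : Fin s ↪ ι, p = pfaffian ((structMat b).submatrix f f)}

/-- Evaluation of a polynomial in `S𝔤` at a point `x ∈ 𝔤*`. -/
noncomputable def evalAt {ι : Type} [Fintype ι] (b : Basis ι k L) (x : Module.Dual k L) :
    MvPolynomial ι k →ₐ[k] k :=
  MvPolynomial.aeval fun i => x (b i)

/-- The vanishing ideal of a subset `Z ⊆ 𝔤*`. -/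
noncomputable def vanIdeal {ι : Type} [Fintype ι] (b : Basis ι k L)
    (Z : Set (Module.Dual k L)) : Ideal (MvPolynomial ι k) where
  carrier := {f | ∀ x ∈ Z, evalAt b x f = 0}
  add_mem' := by intro f g hf hg x hx; simp [map_add, hf x hx, hg x hx]
  zero_mem' := by intro x hx; simp
  smul_mem' := by intro c f hf x hx; simp [smul_eq_mul, map_mul, hf x hx]

/-- The dimension (Krull dimension of the coordinate ring) of the Zariski closure of
a subset `Z ⊆ 𝔤*`. -/
noncomputable def closedDim {ι : Type} [Fintype ι] (b : Basis ι k L)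
    (Z : Set (Module.Dual k L)) : WithBot (WithTop ℕ) :=
  ringKrullDim (MvPolynomial ι k ⧸ vanIdeal b Z)

/-- The rank `r_𝔞(V)` of the structure matrix of the `𝔤`-module `V` with respect to a family
`vs` spanning the acting subalgebra `𝔞`, computed over the fraction field of `S(V)`. -/
noncomputable def rkFam {ι V κ : Type} [Fintype ι] [DecidableEq ι] [Fintype κ]
    [AddCommGroup V] [Module k V] [LieRingModule L V]
    (bV : Basis ι k V) (vs : κ → L) : ℕ :=
  Matrix.rank ((Matrix.of fun (j : ι) (i : κ) => rep bV ⁅vs i, bV j⁆).map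
    (algebraMap (MvPolynomial ι k) (FractionRing (MvPolynomial ι k))))

/-- The map `ρ : A ⊗_k 𝔤 → Der_k(A)` induced by an action of `𝔤` (given on a basis `bG`)
by derivations on a commutative `k`-algebra `A`; `ρ(a ⊗ v) = a • D(v)`. -/
noncomputable def rhoMap {A G κ : Type} [CommRing A] [Algebra k A]
    [AddCommGroup G] [Module k G]
    (bG : Basis κ k G) (D : G → Derivation k A A) :
    TensorProduct k A G →ₗ[A] (A →ₗ[k] A) :=
  (Basis.baseChange A bG).constr k fun i => (D (bG i)).toLinearMap

/-- The invariant subfield `F^𝔤` for an action of `𝔤` by derivations on a field `F ⊇ k`. -/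
noncomputable def invField {F G : Type} [Field F] [Algebra k F]
    (D : G → Derivation k F F) : IntermediateField k F where
  carrier := {x | ∀ v : G, D v x = 0}
  mul_mem' := by intro a b ha hb v; simp [Derivation.leibniz, ha v, hb v]
  one_mem' := by intro v; simp
  add_mem' := by intro a b ha hb v; simp [ha v, hb v]
  zero_mem' := by intro v; simp
  algebraMap_mem' := by intro c v; simp
  inv_mem' := by
    intro x hx v
    rcases eq_or_ne x 0 with h | h
    · simp [h]
    · have h1 : D v (x * x⁻¹) = 0 := by
        rw [mul_inv_cancel₀ h]; simp
      rw [Derivation.leibniz] at h1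
      have h2 : x • D v x⁻¹ = 0 := by
        rw [hx v] at h1; simpa using h1
      rcases smul_eq_zero.1 h2 with h3 | h3
      · exact absurd h3 h
      · exact h3

/-- The action of `𝔤` on a field `F` by derivations is *geometric* if the natural map
`F ⊗_{F^𝔤} 𝔤 → Der_{F^𝔤}(F)` is surjective, i.e. every `k`-derivation of `F` vanishing
on the invariant subfield `F^𝔤` lies in the `F`-span of the derivations coming from `𝔤`. -/
def IsGeometric {F G : Type} [Field F] [Algebra k F]
    (D : G → Derivation k F F) : Prop :=
  ∀ E : Derivation k F F, (∀ x : F, (∀ v : G, D v x = 0) → E x = 0) →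
    E.toLinearMap ∈ Submodule.span F (Set.range fun v : G => (D v).toLinearMap)


/-- The subalgebra of invariants for an action of `G` by derivations on a
commutative `k`-algebra `A`. -/
noncomputable def invariantsOf {A G : Type} [CommRing A] [Algebra k A]
    (D : G → Derivation k A A) : Subalgebra k A where
  carrier := {f | ∀ v : G, D v f = 0}
  mul_mem' := by intro f g hf hg v; simp [Derivation.leibniz, hf v, hg v]
  one_mem' := by intro v; simp
  add_mem' := by intro f g hf hg v; simp [hf v, hg v]
  zero_mem' := by intro v; simp
  algebraMap_mem' := by intro c v; simp

/-- The map `ρ* : S(V) ⊗ V → S(V) ⊗ 𝔤*` dual to the action map, determined by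
`ρ*(1 ⊗ w)(v) = v · w`. -/
noncomputable def rhoStar {ι ιV V : Type} [Fintype ι] [Fintype ιV]
    [AddCommGroup V] [Module k V] [LieRingModule L V]
    (b : Basis ι k L) (bV : Basis ιV k V) :
    TensorProduct k (MvPolynomial ιV k) V →ₗ[MvPolynomial ιV k]
      TensorProduct k (MvPolynomial ιV k) (Module.Dual k L) :=
  (Basis.baseChange (MvPolynomial ιV k) bV).constr k fun j =>
    ∑ i, (rep bV ⁅b i, bV j⁆) ⊗ₜ[k] (b.coord i)

/-- A bundled finite-dimensional Lie algebra over `k` together with a finite basis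
(providing a polynomial model of its symmetric algebra). -/
structure FDLieModel (k : Type) [Field k] where
  carrier : Type
  [lieRing : LieRing carrier]
  [lieAlg : LieAlgebra k carrier]
  ind : Type
  [fin : Fintype ind]
  [deceq : DecidableEq ind]
  basis : Basis ind k carrier

attribute [instance] FDLieModel.lieRing FDLieModel.lieAlg FDLieModel.fin FDLieModel.deceq

section Polynomial

variable {ι V : Type} [Fintype ι] [AddCommGroup V] [Module k V]

/-- `rep` as a linear map. -/
noncomputable def repₗ (c : Basis ι k V) : V →ₗ[k] MvPolynomial ι k where
  toFun := rep c
  map_add' v w := by simp [rep, add_mul, Finset.sum_add_distrib]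
  map_smul' t v := by simp [rep, Finset.smul_sum, MvPolynomial.smul_eq_C_mul, mul_assoc]

lemma repₗ_apply (c : Basis ι k V) (v : V) : repₗ c v = rep c v := rfl

lemma rep_basis (c : Basis ι k V) (i : ι) : rep c (c i) = X i := by
  classical
  simp only [rep, Basis.repr_self, Finsupp.single_apply]
  rw [Finset.sum_eq_single i] <;> simp +contextual [eq_comm]

/-- The derivation of the symmetric algebra extending a linear endomorphism. -/
noncomputable def linDer (c : Basis ι k V) (T : V →ₗ[k] V) :
    Derivation k (MvPolynomial ι k) (MvPolynomial ι k) :=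
  MvPolynomial.mkDerivation k fun i => rep c (T (c i))

/-- The directional derivative along a linear form. -/
noncomputable def dirDer (c : Basis ι k V) (χ : Module.Dual k V) :
    Derivation k (MvPolynomial ι k) (MvPolynomial ι k) :=
  MvPolynomial.mkDerivation k fun i => C (χ (c i))

lemma linDer_rep (c : Basis ι k V) (T : V →ₗ[k] V) (w : V) :
    linDer c T (rep c w) = rep c (T w) := by
  have : (linDer c T).toLinearMap ∘ₗ repₗ c = repₗ c ∘ₗ T := by
    refine c.ext fun i => ?_
    simp [repₗ_apply, rep_basis, linDer]
  exact LinearMap.congr_fun this w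

lemma dirDer_rep (c : Basis ι k V) (χ : Module.Dual k V) (w : V) :
    dirDer c χ (rep c w) = C (χ w) := by
  have : (dirDer c χ).toLinearMap ∘ₗ repₗ c = Algebra.linearMap k (MvPolynomial ι k) ∘ₗ χ := by
    refine c.ext fun i => ?_
    simp [repₗ_apply, rep_basis, dirDer, algebraMap_eq]
  exact LinearMap.congr_fun this w

lemma mkDerivation_eq_sum (f : ι → MvPolynomial ι k) (p : MvPolynomial ι k) :
    mkDerivation k f p = ∑ i, pderiv i p * f i := by
  classical
  have hsum : ∀ q, (∑ i, f i • pderiv i : Derivation k (MvPolynomial ι k) (MvPolynomial ι k)) q =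
      ∑ i, pderiv i q * f i := fun q => by
    refine (congrFun (map_sum (Derivation.coeFnAddMonoidHom :
      Derivation k (MvPolynomial ι k) (MvPolynomial ι k) →+ _) _ _) q).trans ?_
    rw [Finset.sum_apply]
    exact Finset.sum_congr rfl fun i _ => mul_comm _ _
  have : mkDerivation k f = ∑ i, f i • pderiv i := by
    refine derivation_ext fun j => ?_
    rw [mkDerivation_X, hsum, Finset.sum_eq_single j]
    · simp
    · intro i _ hij
      simp [pderiv_X_of_ne hij.symm]
    · simp
  rw [this, hsum]

lemma linDer_add (c : Basis ι k V) (S T : V →ₗ[k] V) (p : MvPolynomial ι k) :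
    linDer c (S + T) p = linDer c S p + linDer c T p := by
  have : linDer c (S + T) = linDer c S + linDer c T :=
    derivation_ext fun i => by
      simp [linDer, ← repₗ_apply]
  rw [this, Derivation.add_apply]

lemma linDer_comm (c : Basis ι k V) (S T : V →ₗ[k] V) (p : MvPolynomial ι k) :
    linDer c S (linDer c T p) - linDer c T (linDer c S p) = linDer c (S ∘ₗ T - T ∘ₗ S) p := by
  have : ⁅linDer c S, linDer c T⁆ = linDer c (S ∘ₗ T - T ∘ₗ S) :=
    derivation_ext fun i => by
      rw [Derivation.commutator_apply, ← rep_basis c, linDer_rep, linDer_rep, linDer_rep,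
        linDer_rep, linDer_rep]
      simp [← repₗ_apply]
  rw [← this, Derivation.commutator_apply]

lemma dirDer_comm (c : Basis ι k V) (χ ψ : Module.Dual k V) (p : MvPolynomial ι k) :
    dirDer c χ (dirDer c ψ p) = dirDer c ψ (dirDer c χ p) := by
  have : ⁅dirDer c χ, dirDer c ψ⁆ = 0 :=
    derivation_ext fun i => by
      rw [Derivation.commutator_apply, ← rep_basis c, dirDer_rep, dirDer_rep]
      simp
  have h := congrArg (fun d => d p) this
  simpa [Derivation.commutator_apply, sub_eq_zero] using h

lemma derivation_iterate_mul_eq_zero {A : Type} [CommRing A] [Algebra k A]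
    (d : Derivation k A A) (m : ℕ) : ∀ (a b : ℕ) (f g : A), a + b ≤ m →
      d^[a] f = 0 → d^[b] g = 0 → d^[m] (f * g) = 0 := by
  induction m with
  | zero =>
    intro a b f g hab hf hg
    obtain rfl : a = 0 := by omega
    simp only [Function.iterate_zero, id] at hf ⊢
    simp [hf]
  | succ m ih =>
    intro a b f g hab hf hg
    rcases a with _ | a
    · simp only [Function.iterate_zero, id] at hf
      rw [hf, zero_mul, iterate_map_zero]
    rcases b with _ | b
    · simp only [Function.iterate_zero, id] at hg
      rw [hg, mul_zero, iterate_map_zero]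
    rw [Function.iterate_succ_apply, Derivation.leibniz, iterate_map_add, smul_eq_mul, smul_eq_mul]
    rw [ih (a + 1) b f (d g) (by omega) hf (by simpa using hg),
      ih (b + 1) a g (d f) (by omega) hg (by simpa using hf), add_zero]

omit [Fintype ι] in
/-- A derivation of a polynomial ring which is locally nilpotent on the variables is locally
nilpotent. -/
lemma exists_iterate_eq_zero (d : Derivation k (MvPolynomial ι k) (MvPolynomial ι k))
    (h : ∀ i, ∃ m, d^[m] (X i) = 0) (p : MvPolynomial ι k) : ∃ m, d^[m] p = 0 := by
  induction p using MvPolynomial.induction_on with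
  | C a => exact ⟨1, by simp⟩
  | add p q hp hq =>
    obtain ⟨a, ha⟩ := hp
    obtain ⟨b, hb⟩ := hq
    refine ⟨a + b, ?_⟩
    rw [iterate_map_add, Function.iterate_add_apply d a b q, hb, add_comm a b,
      Function.iterate_add_apply, ha, iterate_map_zero, iterate_map_zero, add_zero]
  | mul_X p i hp =>
    obtain ⟨a, ha⟩ := hp
    obtain ⟨b, hb⟩ := h i
    exact ⟨a + b, derivation_iterate_mul_eq_zero d _ a b _ _ le_rfl ha hb⟩

/-- If `p * d f = q * f` with `d` locally nilpotent at `f ≠ 0` and killing `p` and `q`, then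
`q = 0`. -/
lemma eq_zero_of_mul_derivation_eq {A : Type} [CommRing A] [IsDomain A] [Algebra k A]
    (d : Derivation k A A) {f p q : A} (hf : f ≠ 0) (hp : d p = 0) (hq : d q = 0)
    (h : p * d f = q * f) (hn : ∃ m, d^[m] f = 0) : q = 0 := by
  obtain ⟨m, hm⟩ := hn
  have key : ∀ n, p ^ n * d^[n] f = q ^ n * f := by
    intro n
    induction n with
    | zero => simp
    | succ n ih =>
      have h1 := congrArg d ih
      rw [Derivation.leibniz, Derivation.leibniz, Derivation.leibniz_pow, Derivation.leibniz_pow,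
        hp, hq] at h1
      simp only [smul_zero, add_zero, smul_eq_mul, mul_zero] at h1
      rw [Function.iterate_succ_apply', pow_succ, pow_succ, mul_comm (p ^ n) p, mul_assoc, h1,
        mul_left_comm, h]
      ring
  have h2 := key m
  rw [hm, mul_zero] at h2
  exact eq_zero_of_pow_eq_zero ((mul_eq_zero.1 h2.symm).resolve_right hf)

omit [Fintype ι] in
lemma dirDer_iterate (c : Basis ι k V) (χ : Module.Dual k V) (p : MvPolynomial ι k) :
    ∃ m, (dirDer c χ)^[m] p = 0 :=
  exists_iterate_eq_zero _ (fun i => ⟨2, by simp [dirDer]⟩) p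

end Polynomial

section SemiInvariants

variable {ι : Type} [Fintype ι]

/-- `f` is zero or a semi-invariant of weight `χ`. -/
def IsSI (b : Basis ι k L) (χ : Module.Dual k L) (f : MvPolynomial ι k) : Prop :=
  ∀ a : L, actDer b a f = χ a • f

lemma actDer_eq_linDer (b : Basis ι k L) (a : L) : actDer b a = linDer b (LieAlgebra.ad k L a) :=
  rfl

lemma actDer_eq_sum (b : Basis ι k L) (a : L) (f : MvPolynomial ι k) :
    actDer b a f = ∑ i, pderiv i f * rep b ⁅a, b i⁆ :=
  mkDerivation_eq_sum _ _

/-- The Poisson bracket of `S𝔤` is antisymmetric. -/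
lemma sum_pderiv_mul_actDer (b : Basis ι k L) (f g : MvPolynomial ι k) :
    ∑ i, pderiv i f * actDer b (b i) g = -∑ i, pderiv i g * actDer b (b i) f := by
  simp only [actDer_eq_sum, Finset.mul_sum]
  rw [Finset.sum_comm, ← Finset.sum_neg_distrib]
  refine Finset.sum_congr rfl fun i _ => ?_
  rw [← Finset.sum_neg_distrib]
  refine Finset.sum_congr rfl fun j _ => ?_
  rw [← lie_skew, ← repₗ_apply, map_neg, repₗ_apply]
  ring

lemma sum_pderiv_mul_actDer_of_isSI (b : Basis ι k L) {χ : Module.Dual k L}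
    (f : MvPolynomial ι k) {g : MvPolynomial ι k} (hg : IsSI b χ g) :
    ∑ i, pderiv i f * actDer b (b i) g = dirDer b χ f * g := by
  rw [dirDer, mkDerivation_eq_sum, Finset.sum_mul]
  refine Finset.sum_congr rfl fun i _ => ?_
  rw [hg, smul_eq_C_mul]
  ring

lemma dirDer_self_eq_zero [CharZero k] (b : Basis ι k L) {χ : Module.Dual k L}
    {f : MvPolynomial ι k} (hf : IsSI b χ f) : dirDer b χ f = 0 := by
  by_cases hf0 : f = 0
  · simp [hf0]
  have h := sum_pderiv_mul_actDer b f f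
  rw [sum_pderiv_mul_actDer_of_isSI b f hf, eq_neg_iff_add_eq_zero, ← two_mul] at h
  simpa [hf0] using h

/-- The weights of semi-invariants are orthogonal to the differentials of semi-invariants. -/
lemma dirDer_eq_zero [CharZero k] (b : Basis ι k L) {χ μ : Module.Dual k L}
    {f g : MvPolynomial ι k} (hf : IsSI b χ f) (hg : IsSI b μ g) (hf0 : f ≠ 0) :
    dirDer b χ g = 0 := by
  have h := sum_pderiv_mul_actDer b f g
  rw [sum_pderiv_mul_actDer_of_isSI b f hg, sum_pderiv_mul_actDer_of_isSI b g hf] at h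
  have h2 := eq_zero_of_mul_derivation_eq (dirDer b μ) (p := g) (q := -dirDer b χ g) hf0
    (dirDer_self_eq_zero b hg)
    (by rw [map_neg, dirDer_comm, dirDer_self_eq_zero b hg]; simp)
    (by rw [mul_comm, h]; ring) (dirDer_iterate b μ f)
  simpa using h2

lemma isSI_one (b : Basis ι k L) : IsSI b 0 1 := fun a => by simp

/-- The weight of a nonzero semi-invariant vanishes on brackets. -/
lemma IsSI.apply_lie {b : Basis ι k L} {χ : Module.Dual k L} {f : MvPolynomial ι k}
    (hf : IsSI b χ f) (hf0 : f ≠ 0) (x y : L) : χ ⁅x, y⁆ = 0 := by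
  have h := linDer_comm b (LieAlgebra.ad k L x) (LieAlgebra.ad k L y) f
  rw [← actDer_eq_linDer, ← actDer_eq_linDer, hf y, hf x, Derivation.map_smul,
    Derivation.map_smul, hf x, hf y, smul_comm, sub_self] at h
  have h2 : LieAlgebra.ad k L x ∘ₗ LieAlgebra.ad k L y - LieAlgebra.ad k L y ∘ₗ LieAlgebra.ad k L x
      = LieAlgebra.ad k L ⁅x, y⁆ :=
    LinearMap.ext fun z => (lie_lie x y z).symm
  rw [h2, ← actDer_eq_linDer, hf] at h
  exact (smul_eq_zero.1 h.symm).resolve_right hf0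

/-- The span of the weights of semi-invariants. -/
def weightSpan (b : Basis ι k L) : Submodule k (Module.Dual k L) :=
  Submodule.span k {χ | ∃ f, f ≠ 0 ∧ IsSI b χ f}

lemma semiCenter_eq_invariantsOf (b : Basis ι k L) (h : weightSpan b = ⊥) :
    semiCenter b (id : L → L) = invariantsOf (fun v : L => actDer b v) := by
  apply le_antisymm
  · refine Algebra.adjoin_le ?_
    rintro f ⟨hf0, χ, hf⟩
    have hχ : χ ∈ weightSpan b := Submodule.subset_span ⟨f, hf0, hf⟩
    rw [h, Submodule.mem_bot] at hχ
    intro v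
    have := hf v
    simpa [hχ] using this
  · intro f hf
    by_cases hf0 : f = 0
    · rw [hf0]; exact zero_mem _
    exact Algebra.subset_adjoin ⟨hf0, 0, fun a => by simpa using hf a⟩

end SemiInvariants

section Graded

/-- Two subalgebras of polynomial rings are isomorphic as graded algebras. -/
def GradedIso {σ τ : Type} (A : Subalgebra k (MvPolynomial σ k))
    (B : Subalgebra k (MvPolynomial τ k)) : Prop :=
  ∃ e : A ≃ₐ[k] B, ∀ (n : ℕ) (x : A),
    MvPolynomial.IsHomogeneous (x : MvPolynomial σ k) n ↔
      MvPolynomial.IsHomogeneous (e x : MvPolynomial τ k) n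

lemma GradedIso.refl {σ : Type} (A : Subalgebra k (MvPolynomial σ k)) : GradedIso A A :=
  ⟨AlgEquiv.refl, fun _ _ => Iff.rfl⟩

lemma GradedIso.symm {σ τ : Type} {A : Subalgebra k (MvPolynomial σ k)}
    {B : Subalgebra k (MvPolynomial τ k)} (h : GradedIso A B) : GradedIso B A := by
  obtain ⟨e, he⟩ := h
  exact ⟨e.symm, fun n x => by rw [he, AlgEquiv.apply_symm_apply]⟩

lemma GradedIso.trans {σ τ υ : Type} {A : Subalgebra k (MvPolynomial σ k)}
    {B : Subalgebra k (MvPolynomial τ k)} {D : Subalgebra k (MvPolynomial υ k)}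
    (h : GradedIso A B) (h' : GradedIso B D) : GradedIso A D := by
  obtain ⟨e, he⟩ := h
  obtain ⟨e', he'⟩ := h'
  exact ⟨e.trans e', fun n x => (he n x).trans (he' n _)⟩

lemma gradedIso_map {σ τ : Type} (A : Subalgebra k (MvPolynomial σ k))
    (j : MvPolynomial σ k →ₐ[k] MvPolynomial τ k) (hj : Function.Injective j)
    (hh : ∀ n p, MvPolynomial.IsHomogeneous p n ↔ MvPolynomial.IsHomogeneous (j p) n) :
    GradedIso A (A.map j) :=
  ⟨A.equivMapOfInjective j hj, fun n x => hh n x⟩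

/-- An algebra morphism intertwining two derivations on the variables intertwines them. -/
lemma algHom_derivation {σ τ : Type} (j : MvPolynomial σ k →ₐ[k] MvPolynomial τ k)
    (d : Derivation k (MvPolynomial σ k) (MvPolynomial σ k))
    (d' : Derivation k (MvPolynomial τ k) (MvPolynomial τ k))
    (h : ∀ i, d' (j (X i)) = j (d (X i))) (p : MvPolynomial σ k) : d' (j p) = j (d p) := by
  induction p using MvPolynomial.induction_on with
  | C a =>
    rw [← algebraMap_eq, AlgHom.commutes, Derivation.map_algebraMap, Derivation.map_algebraMap,
      map_zero]
  | add p q hp hq => simp only [map_add, hp, hq]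
  | mul_X p i hp =>
    rw [map_mul, Derivation.leibniz, Derivation.leibniz, hp, h, map_add]
    simp [smul_eq_mul]

end Graded

section BasisChange

variable {ι ι' V : Type} [Fintype ι] [Fintype ι'] [AddCommGroup V] [Module k V]

/-- The identification of polynomial models of a symmetric algebra. -/
noncomputable def changeBasis (b : Basis ι k V) (B : Basis ι' k V) :
    MvPolynomial ι k →ₐ[k] MvPolynomial ι' k :=
  aeval fun i => rep B (b i)

lemma changeBasis_rep (b : Basis ι k V) (B : Basis ι' k V) (v : V) :
    changeBasis b B (rep b v) = rep B v := by
  have : (changeBasis b B).toLinearMap ∘ₗ repₗ b = repₗ B := by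
    refine b.ext fun i => ?_
    simp [repₗ_apply, rep_basis, changeBasis]
  exact LinearMap.congr_fun this v

lemma changeBasis_changeBasis (b : Basis ι k V) (B : Basis ι' k V) (p : MvPolynomial ι k) :
    changeBasis B b (changeBasis b B p) = p := by
  have : (changeBasis B b).comp (changeBasis b B) = AlgHom.id k _ :=
    algHom_ext fun i => by
      rw [AlgHom.comp_apply, ← rep_basis b i, changeBasis_rep, changeBasis_rep]; rfl
  exact DFunLike.congr_fun this p

lemma rep_isHomogeneous (b : Basis ι k V) (v : V) : (rep b v).IsHomogeneous 1 := by
  refine IsHomogeneous.sum _ _ _ fun i _ => ?_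
  simpa using (isHomogeneous_C ι (b.repr v i)).mul (isHomogeneous_X k i)

omit [Fintype ι] in
lemma changeBasis_isHomogeneous (b : Basis ι k V) (B : Basis ι' k V) {p : MvPolynomial ι k}
    {n : ℕ} (hp : p.IsHomogeneous n) : (changeBasis b B p).IsHomogeneous n := by
  have h := hp.aeval (fun i => rep B (b i)) (fun i => rep_isHomogeneous B (b i))
  rwa [one_mul] at h

lemma linDer_changeBasis (b : Basis ι k V) (B : Basis ι' k V) (T : V →ₗ[k] V)
    (p : MvPolynomial ι k) :
    linDer B T (changeBasis b B p) = changeBasis b B (linDer b T p) := by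
  refine algHom_derivation _ _ _ (fun i => ?_) p
  rw [← rep_basis b i, changeBasis_rep, linDer_rep, linDer_rep, changeBasis_rep]

lemma IsSI.changeBasis {b : Basis ι k L} (B : Basis ι' k L) {χ : Module.Dual k L}
    {f : MvPolynomial ι k} (h : IsSI b χ f) : IsSI B χ (changeBasis b B f) := fun a => by
  rw [actDer_eq_linDer, linDer_changeBasis, ← actDer_eq_linDer, h a, map_smul]

lemma changeBasis_injective (b : Basis ι k V) (B : Basis ι' k V) :
    Function.Injective (changeBasis b B) :=
  Function.LeftInverse.injective (changeBasis_changeBasis b B)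

lemma semiCenter_map_changeBasis_le (b : Basis ι k L) (B : Basis ι' k L) :
    (semiCenter b (id : L → L)).map (changeBasis b B) ≤ semiCenter B (id : L → L) := by
  rw [semiCenter, AlgHom.map_adjoin]
  refine Algebra.adjoin_mono ?_
  rintro _ ⟨f, ⟨hf0, χ, hf⟩, rfl⟩
  exact ⟨(map_ne_zero_iff _ (changeBasis_injective b B)).2 hf0, χ, IsSI.changeBasis B hf⟩

lemma gradedIso_semiCenter_of_bases (b : Basis ι k L) (B : Basis ι' k L) :
    GradedIso (semiCenter b (id : L → L)) (semiCenter B (id : L → L)) := by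
  have h : (semiCenter b (id : L → L)).map (changeBasis b B) = semiCenter B (id : L → L) := by
    refine le_antisymm (semiCenter_map_changeBasis_le b B) fun f hf => ?_
    exact ⟨_, semiCenter_map_changeBasis_le B b ⟨f, hf, rfl⟩, changeBasis_changeBasis B b f⟩
  rw [← h]
  refine gradedIso_map _ _ (changeBasis_injective b B) fun n p =>
    ⟨changeBasis_isHomogeneous b B, fun hp => ?_⟩
  rw [← changeBasis_changeBasis b B p]
  exact changeBasis_isHomogeneous B b hp

lemma weightSpan_le_of_bases (b : Basis ι k L) (B : Basis ι' k L) :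
    weightSpan b ≤ weightSpan B :=
  Submodule.span_mono fun _ ⟨_, hf0, hf⟩ =>
    ⟨_, (map_ne_zero_iff _ (changeBasis_injective b B)).2 hf0, IsSI.changeBasis B hf⟩

lemma weightSpan_eq_of_bases (b : Basis ι k L) (B : Basis ι' k L) :
    weightSpan b = weightSpan B :=
  le_antisymm (weightSpan_le_of_bases b B) (weightSpan_le_of_bases B b)

end BasisChange

section Index

variable {ι : Type} [Fintype ι]

lemma evalAt_rep (b : Basis ι k L) (x : Module.Dual k L) (v : L) :
    evalAt b x (rep b v) = x v := by
  have : (evalAt b x).toLinearMap ∘ₗ repₗ b = x := by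
    refine b.ext fun i => ?_
    simp [repₗ_apply, rep_basis, evalAt]
  exact LinearMap.congr_fun this v

lemma exists_evalAt_ne_zero [Infinite k] (b : Basis ι k L) {θ : MvPolynomial ι k} (h : θ ≠ 0) :
    ∃ x : Module.Dual k L, evalAt b x θ ≠ 0 := by
  by_contra! hx
  refine h (MvPolynomial.funext fun v => ?_)
  have h1 := hx (b.constr k v)
  simpa only [evalAt, Basis.constr_basis, aeval_eq_eval, map_zero] using h1

lemma exists_dual_family {V : Type} [AddCommGroup V] [Module k V] {r : ℕ}
    {f : Fin r → Module.Dual k V} (hf : LinearIndependent k f) :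
    ∃ z : Fin r → V, ∀ i j, f i (z j) = if i = j then 1 else 0 := by
  have hs : Function.Surjective (LinearMap.pi f) := by
    rw [← LinearMap.dualMap_injective_iff, ← LinearMap.ker_eq_bot, LinearMap.ker_eq_bot']
    intro g hg
    refine LinearMap.pi_ext' fun i => LinearMap.ext_ring ?_
    have h2 : ∑ i, g (Pi.single i 1) • f i = 0 := by
      refine LinearMap.ext fun v => ?_
      have h3 := LinearMap.congr_fun hg v
      rw [LinearMap.dualMap_apply, LinearMap.zero_apply] at h3
      rw [LinearMap.zero_apply, ← h3, LinearMap.pi_apply_eq_sum_univ g]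
      simp only [LinearMap.sum_apply, LinearMap.smul_apply, smul_eq_mul, LinearMap.pi_apply]
      refine Finset.sum_congr rfl fun i _ => ?_
      rw [mul_comm, show (fun j => if i = j then (1 : k) else 0) = Pi.single i 1 from
        funext fun j => by simp [Pi.single_apply, eq_comm]]
    simpa using Fintype.linearIndependent_iff.1 hf _ h2 i
  choose z hz using fun j => hs (Pi.single j 1)
  refine ⟨z, fun i j => ?_⟩
  have := congrFun (hz j) i
  rw [LinearMap.pi_apply] at this
  rw [this, Pi.single_apply]

/-- Away from the zeros of a given nonzero polynomial there is a regular point. -/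
lemma exists_regular [Infinite k] (b : Basis ι k L) {θ : MvPolynomial ι k} (h : θ ≠ 0) :
    ∃ x : Module.Dual k L, evalAt b x θ ≠ 0 ∧ finrank k (stab k L x) = lieIndex k L := by
  have : Module.Finite k L := Module.Finite.of_basis b
  obtain ⟨y, hy⟩ : ∃ y, finrank k (stab k L y) = lieIndex k L := ciInf_mem
    fun x : Module.Dual k L => finrank k (stab k L x)
  obtain ⟨W, hW⟩ := Submodule.exists_isCompl (stab k L y)
  let w := Module.finBasis k W
  have hli : LinearIndependent k
      fun i => (y ∘ₗ (LieAlgebra.ad k L (w i : L) : L →ₗ[k] L) : Module.Dual k L) := by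
    rw [Fintype.linearIndependent_iff]
    intro c hc
    have hmem : ((∑ i, c i • w i : W) : L) ∈ stab k L y := by
      intro v
      have := LinearMap.congr_fun hc v
      simpa [LinearMap.sum_apply, sum_lie, smul_lie] using this
    have h0 : (∑ i, c i • w i : W) = 0 := by
      have := (Submodule.disjoint_def.1 hW.disjoint) _ hmem (Subtype.property _)
      exact Subtype.ext this
    exact Fintype.linearIndependent_iff.1 w.linearIndependent c h0
  obtain ⟨z, hz⟩ := exists_dual_family hli
  let M : Matrix (Fin (finrank k W)) (Fin (finrank k W)) (MvPolynomial ι k) :=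
    Matrix.of fun i j => rep b ⁅(w i : L), z j⁆
  have hM : ∀ x, evalAt b x M.det = (Matrix.of fun i j => x ⁅(w i : L), z j⁆).det := by
    intro x
    rw [AlgHom.map_det]
    congr 1
    ext i j
    simp [M, evalAt_rep]
  have hM0 : M.det ≠ 0 := by
    intro h0
    have h1 := hM y
    have h2 : (Matrix.of fun i j => y ⁅(w i : L), z j⁆) = 1 := by
      ext i j
      simpa [Matrix.one_apply] using hz i j
    rw [h0, map_zero, h2, Matrix.det_one] at h1
    exact zero_ne_one h1
  obtain ⟨x, hx⟩ := exists_evalAt_ne_zero b (mul_ne_zero h hM0)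
  rw [map_mul] at hx
  refine ⟨x, left_ne_zero_of_mul hx, le_antisymm ?_ (ciInf_le (OrderBot.bddBelow _) x)⟩
  have hdet := right_ne_zero_of_mul hx
  rw [hM] at hdet
  have hdisj : Disjoint (stab k L x) W := by
    rw [Submodule.disjoint_def]
    intro v hv hvW
    have hc : Matrix.vecMul (w.repr ⟨v, hvW⟩) (Matrix.of fun i j => x ⁅(w i : L), z j⁆) = 0 := by
      funext j
      have h1 := hv (z j)
      have h2 : v = ∑ i, w.repr ⟨v, hvW⟩ i • (w i : L) := by
        have := congrArg (Subtype.val) (w.sum_repr ⟨v, hvW⟩)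
        rw [AddSubmonoidClass.coe_finsetSum] at this
        exact this.symm
      rw [h2, sum_lie, map_sum] at h1
      simpa [Matrix.vecMul, dotProduct, smul_lie] using h1
    have h3 := Matrix.eq_zero_of_vecMul_eq_zero hdet hc
    have h4 : w.repr ⟨v, hvW⟩ = 0 := DFunLike.coe_injective h3
    have h5 := w.repr.map_eq_zero_iff.1 h4
    exact congrArg Subtype.val h5
  have h1 := Submodule.finrank_add_finrank_le_of_disjoint hdisj
  have h2 := Submodule.finrank_add_eq_of_isCompl hW
  omega

end Index

section Extension

variable {g h : Type} [LieRing g] [LieAlgebra k g] [LieRing h] [LieAlgebra k h] {n : ℕ}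

/-- `g` is the extension of an ideal `h` (embedded by `φ`) by the basis vector `B 0`, which acts on
`h` as the derivation `D`. -/
structure IsExtension (c : Basis (Fin n) k h) (B : Basis (Fin (n + 1)) k g) (φ : h →ₗ⁅k⁆ g)
    (D : LieDerivation k h h) : Prop where
  basis : ∀ i, B i.succ = φ (c i)
  lie : ∀ w, ⁅B 0, φ w⁆ = φ (D w)

/-- The inclusion of the polynomial ring in all variables but the first. -/
noncomputable abbrev succIncl (k : Type) [Field k] (n : ℕ) :
    MvPolynomial (Fin n) k →ₐ[k] MvPolynomial (Fin (n + 1)) k :=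
  rename Fin.succ

lemma succIncl_injective : Function.Injective (succIncl k n) :=
  rename_injective _ (Fin.succ_injective n)

lemma mem_range_succIncl [CharZero k] {p : MvPolynomial (Fin (n + 1)) k} (hp : pderiv 0 p = 0) :
    ∃ q, succIncl k n q = p := by
  classical
  refine MvPolynomial.exists_rename_eq_of_vars_subset_range p _ (Fin.succ_injective n) ?_
  intro i hi
  rw [Fin.range_succ]
  rintro rfl
  obtain ⟨d, hd, h0⟩ := (mem_vars_iff_mem_support _).1 (Finset.mem_coe.1 hi)
  have h1 := congrArg (coeff (d - Finsupp.single 0 1)) hp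
  have hd0 : d 0 ≠ 0 := Finsupp.mem_support_iff.1 h0
  have hle : Finsupp.single (0 : Fin (n + 1)) 1 ≤ d := by
    rw [Finsupp.single_le_iff]; omega
  rw [coeff_pderiv, tsub_add_cancel_of_le hle, coeff_zero] at h1
  rcases mul_eq_zero.1 h1 with h2 | h2
  · exact (mem_support_iff.1 hd) h2
  · have h3 : ((d 0 : ℕ) : k) = 0 := by
      rw [← h2, Finsupp.tsub_apply, Finsupp.single_eq_same]
      exact_mod_cast congrArg (Nat.cast (R := k)) (Nat.succ_pred_eq_of_ne_zero hd0).symm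
    exact hd0 (by exact_mod_cast h3)

namespace IsExtension

variable {c : Basis (Fin n) k h} {B : Basis (Fin (n + 1)) k g} {φ : h →ₗ⁅k⁆ g}
  {D : LieDerivation k h h}

lemma succIncl_rep (H : IsExtension c B φ D) (w : h) :
    succIncl k n (rep c w) = rep B (φ w) := by
  have : (succIncl k n).toLinearMap ∘ₗ repₗ c = repₗ B ∘ₗ (φ : h →ₗ[k] g) := by
    refine c.ext fun i => ?_
    simp [repₗ_apply, rep_basis, ← H.basis]
  exact LinearMap.congr_fun this w

lemma actDer_succIncl (H : IsExtension c B φ D) (a : h) (f : MvPolynomial (Fin n) k) :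
    actDer B (φ a) (succIncl k n f) = succIncl k n (actDer c a f) := by
  refine algHom_derivation _ _ _ (fun i => ?_) f
  rw [← rep_basis c, H.succIncl_rep, actDer_eq_linDer, actDer_eq_linDer, linDer_rep, linDer_rep,
    H.succIncl_rep, LieAlgebra.ad_apply, LieAlgebra.ad_apply, LieHom.map_lie]

lemma actDer_zero_succIncl (H : IsExtension c B φ D) (f : MvPolynomial (Fin n) k) :
    actDer B (B 0) (succIncl k n f) = succIncl k n (linDer c (D : h →ₗ[k] h) f) := by
  refine algHom_derivation _ _ _ (fun i => ?_) f
  rw [← rep_basis c, H.succIncl_rep, actDer_eq_linDer, linDer_rep, linDer_rep,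
    H.succIncl_rep, LieAlgebra.ad_apply, H.lie]
  rfl

lemma dirDer_succIncl (H : IsExtension c B φ D) (ξ : Module.Dual k g)
    (f : MvPolynomial (Fin n) k) :
    dirDer B ξ (succIncl k n f) = succIncl k n (dirDer c (ξ ∘ₗ (φ : h →ₗ[k] g)) f) := by
  refine algHom_derivation _ _ _ (fun i => ?_) f
  rw [← rep_basis c, H.succIncl_rep, dirDer_rep, dirDer_rep]
  simp

lemma evalAt_succIncl (H : IsExtension c B φ D) (x : Module.Dual k g)
    (f : MvPolynomial (Fin n) k) :
    evalAt B x (succIncl k n f) = evalAt c (x ∘ₗ (φ : h →ₗ[k] g)) f := by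
  simp [evalAt, aeval_rename, Function.comp_def, H.basis]

lemma exists_decomp (H : IsExtension c B φ D) (v : g) : ∃ a, v = B.repr v 0 • B 0 + φ a := by
  refine ⟨∑ i, B.repr v i.succ • c i, ?_⟩
  conv_lhs => rw [← B.sum_repr v, Fin.sum_univ_succ]
  simp [H.basis]

lemma injective (H : IsExtension c B φ D) : Function.Injective φ := by
  refine (injective_iff_map_eq_zero φ).2 fun a ha => ?_
  have h1 : rep c a = 0 := by
    refine succIncl_injective ?_
    rw [H.succIncl_rep, ha, ← repₗ_apply, map_zero, map_zero]
  refine c.ext_elem fun i => ?_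
  have h2 := dirDer_rep c (c.coord i) a
  rw [h1, map_zero] at h2
  simpa using h2.symm

lemma finrank_stab (H : IsExtension c B φ D) {μ : Module.Dual k h}
    {u w : MvPolynomial (Fin n) k} (hu : IsSI c μ u) (hw : IsSI c μ w) (x : Module.Dual k g)
    (hx : evalAt c (x ∘ₗ (φ : h →ₗ[k] g))
      (w * linDer c (D : h →ₗ[k] h) u - u * linDer c (D : h →ₗ[k] h) w) ≠ 0) :
    finrank k (stab k h (x ∘ₗ (φ : h →ₗ[k] g))) = finrank k (stab k g x) + 1 := by
  have : Module.Finite k h := Module.Finite.of_basis c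
  set y : Module.Dual k h := x ∘ₗ (φ : h →ₗ[k] g) with hy
  have hyx : ∀ a, y a = x (φ a) := fun a => rfl
  let z : h := ∑ i, evalAt c y (w * pderiv i u - u * pderiv i w) • c i
  have hz : ∀ T : h →ₗ[k] h, y (T z) = evalAt c y (w * linDer c T u - u * linDer c T w) := by
    intro T
    rw [linDer, mkDerivation_eq_sum, mkDerivation_eq_sum]
    simp only [z, map_sum, map_smul, map_sub, map_mul, evalAt_rep, Finset.mul_sum, smul_eq_mul,
      ← Finset.sum_sub_distrib]
    exact Finset.sum_congr rfl fun i _ => by ring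
  have hzS : z ∈ stab k h y := by
    intro v
    have h1 := hz (LieAlgebra.ad k h v)
    rw [← actDer_eq_linDer, hu, hw, LieAlgebra.ad_apply, mul_smul_comm, mul_smul_comm,
      mul_comm u w, sub_self, map_zero] at h1
    rw [← lie_skew, map_neg, h1, neg_zero]
  let ℓ : stab k h y →ₗ[k] k := (y ∘ₗ (D : h →ₗ[k] h)).domRestrict (stab k h y)
  have hℓz : ℓ ⟨z, hzS⟩ ≠ 0 := by
    have h1 := hz (D : h →ₗ[k] h)
    rw [← h1] at hx
    exact hx
  have hrange : LinearMap.range ℓ = ⊤ := LinearMap.range_eq_top.2 (LinearMap.surjective (by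
    rintro h0
    rw [h0] at hℓz
    exact hℓz rfl))
  have hrank := LinearMap.finrank_range_add_finrank_ker ℓ
  rw [hrange, finrank_top, finrank_self] at hrank
  have hmap : stab k g x = (LinearMap.ker ℓ).map ((φ : h →ₗ[k] g) ∘ₗ (stab k h y).subtype) := by
    apply le_antisymm
    · intro v hv
      obtain ⟨a, ha⟩ := H.exists_decomp v
      have h0 : B.repr v 0 = 0 := by
        have h1 := hv (φ z)
        rw [ha, add_lie, smul_lie, H.lie, ← LieHom.map_lie, map_add, map_smul, ← hyx, ← hyx,
          ← lie_skew, map_neg, hzS a, neg_zero, add_zero, smul_eq_mul] at h1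
        exact (mul_eq_zero.1 h1).resolve_right hℓz
      rw [h0, zero_smul, zero_add] at ha
      subst ha
      refine ⟨⟨a, fun b => ?_⟩, ?_, rfl⟩
      · rw [hyx, LieHom.map_lie]
        exact hv _
      · have h1 := hv (B 0)
        rw [← lie_skew, map_neg, neg_eq_zero, H.lie] at h1
        exact h1
    · rintro _ ⟨⟨a, ha⟩, ha', rfl⟩ v
      obtain ⟨b, hb⟩ := H.exists_decomp v
      have h2 : x (φ (D a)) = 0 := ha'
      have h3 : x (φ ⁅a, b⁆) = 0 := ha b
      change x ⁅φ a, v⁆ = 0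
      rw [hb, lie_add, lie_smul, ← lie_skew, H.lie, ← LieHom.map_lie, map_add, h3, map_smul,
        map_neg, h2]
      simp
  have hinj : Function.Injective ((φ : h →ₗ[k] g) ∘ₗ (stab k h y).subtype) :=
    H.injective.comp Subtype.val_injective
  rw [hmap, ← (Submodule.equivMapOfInjective _ hinj (LinearMap.ker ℓ)).finrank_eq, ← hrank,
    add_comm]

/-- The index drops by one in an extension by a derivation which does not preserve the quotient of
two semi-invariants of equal weight. -/
lemma lieIndex_add_one [CharZero k] (H : IsExtension c B φ D) {μ : Module.Dual k h}
    {u w : MvPolynomial (Fin n) k} (hu : IsSI c μ u) (hw : IsSI c μ w)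
    (hne : w * linDer c (D : h →ₗ[k] h) u - u * linDer c (D : h →ₗ[k] h) w ≠ 0) :
    lieIndex k g + 1 = lieIndex k h := by
  apply le_antisymm
  · obtain ⟨y, hy, hy'⟩ := exists_regular c hne
    let x : Module.Dual k g := B.constr k (Fin.cons 0 fun i => y (c i))
    have hx : x ∘ₗ (φ : h →ₗ[k] g) = y := by
      refine c.ext fun i => ?_
      simp [x, ← H.basis]
    have h1 := H.finrank_stab hu hw x (by rwa [hx])
    rw [hx, hy'] at h1
    rw [h1]
    exact Nat.succ_le_succ (ciInf_le (OrderBot.bddBelow _) x)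
  · obtain ⟨x, hx, hx'⟩ := exists_regular B
      ((map_ne_zero_iff _ (succIncl_injective (k := k) (n := n))).2 hne)
    rw [H.evalAt_succIncl] at hx
    rw [← hx', ← H.finrank_stab hu hw x hx]
    exact ciInf_le (OrderBot.bddBelow _) _

lemma finrank_eq (c : Basis (Fin n) k h) (B : Basis (Fin (n + 1)) k g) :
    finrank k g = finrank k h + 1 := by
  rw [finrank_eq_card_basis c, finrank_eq_card_basis B]; simp

end IsExtension

end Extension

section Eigen

variable {V : Type} [AddCommGroup V] [Module k V]

/-- The eigen-components of a vector of an invariant subspace lie in that subspace. -/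
lemma eigen_components_mem (f : Module.End k V) (p : Submodule k V) (hp : ∀ x ∈ p, f x ∈ p)
    (T : Finset k) : ∀ m : k → V, (∀ μ ∈ T, f (m μ) = μ • m μ) → ∑ μ ∈ T, m μ ∈ p →
      ∀ μ ∈ T, m μ ∈ p := by
  classical
  induction T using Finset.induction_on with
  | empty => simp
  | insert ν T hν ih =>
    intro m hm hsum
    have h1 : ∑ μ ∈ T, (μ - ν) • m μ ∈ p := by
      have h2 := p.sub_mem (hp _ hsum) (p.smul_mem ν hsum)
      rw [Finset.sum_insert hν, map_add, map_sum, smul_add, hm ν (Finset.mem_insert_self _ _),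
        Finset.smul_sum, add_sub_add_left_eq_sub, ← Finset.sum_sub_distrib] at h2
      convert h2 using 1
      refine Finset.sum_congr rfl fun μ hμ => ?_
      rw [hm μ (Finset.mem_insert_of_mem hμ), sub_smul]
    have h3 : ∀ μ ∈ T, m μ ∈ p := by
      intro μ hμ
      have h4 := ih (fun μ => (μ - ν) • m μ) (fun μ hμ => by
        simp only [map_smul]
        rw [hm μ (Finset.mem_insert_of_mem hμ), smul_comm]) h1 μ hμ
      exact (p.smul_mem_iff (sub_ne_zero.2 (by rintro rfl; exact hν hμ))).1 h4
    intro μ hμ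
    rcases Finset.mem_insert.1 hμ with rfl | hμ
    · rw [Finset.sum_insert hν] at hsum
      exact (p.add_mem_iff_left (p.sum_mem h3)).1 hsum
    · exact h3 μ hμ

lemma exists_eigen_components {f : Module.End k V} (htop : ⨆ μ, f.eigenspace μ = ⊤) (x : V) :
    ∃ (T : Finset k) (m : k → V), (∀ μ, f (m μ) = μ • m μ) ∧ ∑ μ ∈ T, m μ = x := by
  have hx : x ∈ ⨆ μ, f.eigenspace μ := htop ▸ Submodule.mem_top
  obtain ⟨m, hm, hsum⟩ := (Submodule.mem_iSup_iff_exists_finsupp _ _).1 hx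
  exact ⟨m.support, m, fun μ => Module.End.mem_eigenspace_iff.1 (hm μ), hsum⟩

lemma apply_eq_zero_of_iterate {n : Module.End k V} {x : V} {μ : k} (hx : n x = μ • x)
    (hn : ∃ m, n^[m] x = 0) : n x = 0 := by
  obtain ⟨m, hm⟩ := hn
  have h : ∀ m, n^[m] x = μ ^ m • x := by
    intro m
    induction m with
    | zero => simp
    | succ m ih => rw [Function.iterate_succ_apply', ih, map_smul, hx, smul_smul, pow_succ]
  rw [h, smul_eq_zero] at hm
  rcases hm with h0 | h0
  · rw [hx, eq_zero_of_pow_eq_zero h0, zero_smul]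
  · rw [h0, map_zero]

/-- An eigenvector of a sum of commuting diagonalizable and locally nilpotent endomorphisms is
killed by the nilpotent part. -/
lemma nilpotent_part_apply_eq_zero {s n : Module.End k V} (htop : ⨆ μ, s.eigenspace μ = ⊤)
    (hcomm : ∀ x, s (n x) = n (s x)) (hn : ∀ x, ∃ m, n^[m] x = 0) {x : V} {l : k}
    (hx : s x + n x = l • x) : n x = 0 := by
  obtain ⟨T, m, hm, rfl⟩ := exists_eigen_components htop x
  have h0 := eigen_components_mem s ⊥ (fun x hx => by
    rw [Submodule.mem_bot] at hx; rw [hx, map_zero]; exact Submodule.zero_mem _) T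
    (fun μ => s (m μ) + n (m μ) - l • m μ)
    (fun μ _ => by simp only [map_sub, map_add, map_smul, hcomm, hm, smul_add, smul_sub,
      smul_comm l μ])
    (by
      rw [Finset.sum_sub_distrib, Finset.sum_add_distrib, ← map_sum, ← map_sum, hx,
        Finset.smul_sum, sub_self]
      exact Submodule.zero_mem _)
  rw [map_sum]
  refine Finset.sum_eq_zero fun μ hμ => ?_
  have h1 := (Submodule.mem_bot k).1 (h0 μ hμ)
  refine apply_eq_zero_of_iterate (μ := l - μ) ?_ (hn _)
  rw [hm μ, sub_eq_zero] at h1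
  rw [sub_smul, ← h1]
  abel

end Eigen

section LinDer

variable {ι V : Type} [Fintype ι] [AddCommGroup V] [Module k V]

lemma iSup_eigenspace_linDer (c : Basis ι k V) {s : Module.End k V}
    (htop : ⨆ μ, s.eigenspace μ = ⊤) :
    ⨆ μ, Module.End.eigenspace (linDer c s).toLinearMap μ = ⊤ := by
  set E := ⨆ μ, Module.End.eigenspace (linDer c s).toLinearMap μ with hE
  have mem : ∀ {p μ}, linDer c s p = μ • p → p ∈ E := fun {p μ} hp =>
    Submodule.mem_iSup_of_mem μ (Module.End.mem_eigenspace_iff.2 hp)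
  have hmul : ∀ p ∈ E, ∀ q ∈ E, p * q ∈ E := by
    intro p hp q hq
    refine Submodule.iSup_induction _ (motive := fun p => p * q ∈ E) hp (fun μ p hp => ?_)
      (by simp) (fun x y hx hy => by rw [add_mul]; exact E.add_mem hx hy)
    refine Submodule.iSup_induction _ (motive := fun q => p * q ∈ E) hq (fun ν q hq => ?_)
      (by simp) (fun x y hx hy => by rw [mul_add]; exact E.add_mem hx hy)
    have hp' : linDer c s p = μ • p := Module.End.mem_eigenspace_iff.1 hp
    have hq' : linDer c s q = ν • q := Module.End.mem_eigenspace_iff.1 hq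
    refine mem (μ := μ + ν) ?_
    rw [Derivation.leibniz, hp', hq']
    simp only [smul_eq_mul, smul_eq_C_mul, map_add]
    ring
  have hX : ∀ v, rep c v ∈ E := by
    intro v
    have hv : v ∈ ⨆ μ, s.eigenspace μ := htop ▸ Submodule.mem_top
    refine Submodule.iSup_induction _ (motive := fun v => rep c v ∈ E) hv (fun μ v hv => ?_)
      ?_ (fun x y hx hy => ?_)
    · refine mem (μ := μ) ?_
      rw [linDer_rep, Module.End.mem_eigenspace_iff.1 hv, ← repₗ_apply, map_smul, repₗ_apply]
    · rw [← repₗ_apply, map_zero]; exact E.zero_mem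
    · rw [← repₗ_apply, map_add]; exact E.add_mem hx hy
  rw [eq_top_iff]
  rintro p -
  induction p using MvPolynomial.induction_on with
  | C a =>
    refine mem (μ := 0) ?_
    rw [← algebraMap_eq, Derivation.map_algebraMap, zero_smul]
  | add p q hp hq => exact E.add_mem hp hq
  | mul_X p i hp => exact hmul _ hp _ (rep_basis c i ▸ hX _)

lemma linDer_iterate_eq_zero (c : Basis ι k V) {n : Module.End k V} (hn : IsNilpotent n)
    (p : MvPolynomial ι k) : ∃ m, (linDer c n)^[m] p = 0 := by
  refine exists_iterate_eq_zero _ (fun i => ?_) p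
  obtain ⟨m, hm⟩ := hn
  refine ⟨m, ?_⟩
  have h : ∀ m, (linDer c n)^[m] (X i) = rep c ((n ^ m) (c i)) := by
    intro m
    induction m with
    | zero => simp [rep_basis]
    | succ m ih => rw [Function.iterate_succ_apply', ih, linDer_rep, pow_succ']; rfl
  rw [h, hm, LinearMap.zero_apply, ← repₗ_apply, map_zero]

lemma linDer_totalDegree_le (c : Basis ι k V) (T : Module.End k V) {p : MvPolynomial ι k} {d : ℕ}
    (hp : p.totalDegree ≤ d) : (linDer c T p).totalDegree ≤ d := by
  rw [← sum_homogeneousComponent p, map_sum]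
  refine totalDegree_finsetSum_le fun i hi => ?_
  have hi' : i ≤ d := by rw [Finset.mem_range] at hi; omega
  rcases Nat.eq_zero_or_pos i with rfl | hpos
  · rw [homogeneousComponent_zero, ← algebraMap_eq, Derivation.map_algebraMap]; simp
  refine (IsHomogeneous.totalDegree_le (n := i) ?_).trans hi'
  rw [linDer, mkDerivation_eq_sum]
  refine IsHomogeneous.sum _ _ _ fun j _ => ?_
  have := ((homogeneousComponent_isHomogeneous i p).pderiv (i := j)).mul
    (rep_isHomogeneous c (T (c j)))
  rwa [Nat.sub_add_cancel hpos] at this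

/-- Derivations induced by linear maps are locally finite. -/
lemma exists_iterate_mem_span (c : Basis ι k V) (T : Module.End k V) (p : MvPolynomial ι k) :
    ∃ m, (linDer c T)^[m] p ∈
      Submodule.span k ((fun i => (linDer c T)^[i] p) '' Set.Iio m) := by
  by_contra! hcon
  set v : ℕ → MvPolynomial ι k := fun i => (linDer c T)^[i] p with hv
  have hV : ∀ i, v i ∈ restrictTotalDegree ι k p.totalDegree := by
    intro i
    rw [mem_restrictTotalDegree]
    induction i with
    | zero => exact le_rfl
    | succ i ih =>
      rw [hv]
      simp only
      rw [Function.iterate_succ_apply']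
      exact linDer_totalDegree_le c T ih
  have hmono : StrictMono fun m => Submodule.span k (v '' Set.Iio m) := by
    refine strictMono_nat_of_lt_succ fun m => ?_
    refine lt_of_le_of_ne (Submodule.span_mono (Set.image_mono (Set.Iio_subset_Iio m.le_succ)))
      fun h => hcon m ?_
    rw [h]
    exact Submodule.subset_span ⟨m, Nat.lt_succ_self m, rfl⟩
  have hle : ∀ m, Submodule.span k (v '' Set.Iio m) ≤ restrictTotalDegree ι k p.totalDegree := by
    intro m
    rw [Submodule.span_le]
    rintro _ ⟨i, -, rfl⟩
    exact hV i
  have hrank : ∀ m, m ≤ finrank k (Submodule.span k (v '' Set.Iio m)) := by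
    intro m
    induction m with
    | zero => exact Nat.zero_le _
    | succ m ih =>
      have : Module.Finite k (Submodule.span k (v '' Set.Iio (m + 1))) :=
        Submodule.finiteDimensional_of_le (hle _)
      exact Nat.succ_le_of_lt (ih.trans_lt (Submodule.finrank_lt_finrank_of_lt
        (hmono (Nat.lt_succ_self m))))
  have h1 := hrank (finrank k (restrictTotalDegree ι k p.totalDegree) + 1)
  have h2 := Submodule.finrank_mono (hle (finrank k (restrictTotalDegree ι k p.totalDegree) + 1))
  omega

end LinDer

section WeightsAndDerivations

variable {ι : Type} [Fintype ι]

lemma linDer_actDer (b : Basis ι k L) (T : LieDerivation k L L) (a : L) (f : MvPolynomial ι k) :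
    actDer b a (linDer b (T : L →ₗ[k] L) f) =
      linDer b (T : L →ₗ[k] L) (actDer b a f) - actDer b (T a) f := by
  have h := linDer_comm b (LieAlgebra.ad k L a : L →ₗ[k] L) (T : L →ₗ[k] L) f
  have h2 : (LieAlgebra.ad k L a : L →ₗ[k] L) ∘ₗ (T : L →ₗ[k] L) -
      (T : L →ₗ[k] L) ∘ₗ (LieAlgebra.ad k L a : L →ₗ[k] L) =
        -(LieAlgebra.ad k L (T a) : L →ₗ[k] L) := by
    ext z
    simp
  rw [h2] at h
  have h3 : linDer b (-(LieAlgebra.ad k L (T a) : L →ₗ[k] L)) f = -actDer b (T a) f := by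
    have : linDer b (-(LieAlgebra.ad k L (T a) : L →ₗ[k] L)) = -actDer b (T a) :=
      derivation_ext fun i => by
        rw [Derivation.neg_apply, actDer_eq_linDer, ← rep_basis b, linDer_rep, linDer_rep]
        rw [LinearMap.neg_apply, ← repₗ_apply, map_neg, repₗ_apply]
    rw [this, Derivation.neg_apply]
  rw [h3] at h
  rw [actDer_eq_linDer, actDer_eq_linDer, ← sub_eq_zero]
  rw [actDer_eq_linDer] at h
  rw [← sub_eq_zero] at h
  rw [← h]
  ring

/-- Weights of semi-invariants vanish on the image of every derivation. -/
lemma IsSI.apply_derivation [CharZero k] {b : Basis ι k L} {χ : Module.Dual k L}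
    {f : MvPolynomial ι k} (hf : IsSI b χ f) (hf0 : f ≠ 0) (T : LieDerivation k L L) (a : L) :
    χ (T a) = 0 := by
  classical
  set t := linDer b (T : L →ₗ[k] L) with ht
  let K : ℕ → Submodule k (MvPolynomial ι k) := fun m =>
    Submodule.span k ((fun i => t^[i] f) '' Set.Iio m)
  have hKmono : Monotone K := fun m m' h =>
    Submodule.span_mono (Set.image_mono (Set.Iio_subset_Iio h))
  have hmem : ∀ {i m}, i < m → t^[i] f ∈ K m := fun {i m} h =>
    Submodule.subset_span ⟨i, h, rfl⟩
  have hKt : ∀ m, ∀ p ∈ K m, t p ∈ K (m + 1) := by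
    intro m p hp
    induction hp using Submodule.span_induction with
    | mem x hx =>
      obtain ⟨i, hi, rfl⟩ := hx
      have : t (t^[i] f) = t^[i + 1] f := (Function.iterate_succ_apply' _ _ _).symm
      rw [this]
      exact hmem (Nat.succ_lt_succ hi)
    | zero => rw [map_zero]; exact Submodule.zero_mem _
    | add x y _ _ hx hy => rw [map_add]; exact Submodule.add_mem _ hx hy
    | smul a x _ hx => rw [Derivation.map_smul]; exact Submodule.smul_mem _ _ hx
  have h1 : ∀ m a, actDer b a (t^[m] f) - χ a • t^[m] f ∈ K m := by
    intro m
    induction m with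
    | zero =>
      intro a
      rw [Function.iterate_zero, id, hf a, sub_self]
      exact Submodule.zero_mem _
    | succ m ih =>
      intro a
      rw [Function.iterate_succ_apply', linDer_actDer]
      have e1 := hKt m _ (ih a)
      have e2 := hKmono m.le_succ (ih (T a))
      have e3 : χ (T a) • t^[m] f ∈ K (m + 1) := Submodule.smul_mem _ _ (hmem m.lt_succ_self)
      rw [map_sub, Derivation.map_smul] at e1
      have e4 := Submodule.sub_mem _ e1 (Submodule.add_mem _ e2 e3)
      convert e4 using 1
      abel
  have h2 : ∀ m, actDer b a (t^[m + 1] f) - χ a • t^[m + 1] f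
      + ((m + 1 : ℕ) : k) • χ (T a) • t^[m] f ∈ K m := by
    intro m
    induction m with
    | zero =>
      have : actDer b a (t^[0 + 1] f) - χ a • t^[0 + 1] f
          + ((0 + 1 : ℕ) : k) • χ (T a) • t^[0] f = 0 := by
        simp only [zero_add, Function.iterate_one, Function.iterate_zero, id, Nat.cast_one,
          one_smul]
        rw [linDer_actDer, hf a, hf (T a), Derivation.map_smul]
        abel
      rw [this]
      exact Submodule.zero_mem _
    | succ m ih =>
      rw [Function.iterate_succ_apply', linDer_actDer]
      have e1 := hKt m _ ih
      have e2 := h1 (m + 1) (T a)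
      rw [map_add, map_sub, Derivation.map_smul, Derivation.map_smul, Derivation.map_smul,
        ← Function.iterate_succ_apply' t m f] at e1
      have e4 := Submodule.sub_mem _ e1 e2
      convert e4 using 1
      push_cast
      simp only [add_smul, one_smul]
      abel
  have hex : ∃ m, t^[m] f ∈ K m := exists_iterate_mem_span b (T : L →ₗ[k] L) f
  obtain ⟨m, hm⟩ : ∃ m, Nat.find hex = m + 1 := by
    refine Nat.exists_eq_succ_of_ne_zero fun h0 => hf0 ?_
    have := Nat.find_spec hex
    rw [h0] at this
    simpa [K] using this
  have hspec := Nat.find_spec hex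
  rw [hm] at hspec
  have hmin : t^[m] f ∉ K m := Nat.find_min hex (by omega)
  have hstab : ∀ p ∈ K (m + 1), actDer b a p - χ a • p ∈ K m := by
    intro p hp
    induction hp using Submodule.span_induction with
    | mem x hx =>
      obtain ⟨i, hi, rfl⟩ := hx
      exact hKmono (Nat.lt_succ_iff.1 hi) (h1 i a)
    | zero => simp
    | add x y _ _ hx hy =>
      have := Submodule.add_mem _ hx hy
      convert this using 1
      rw [map_add, smul_add]; abel
    | smul l x _ hx =>
      have := Submodule.smul_mem _ l hx
      convert this using 1
      rw [Derivation.map_smul, smul_sub, smul_comm]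
  have h3 := Submodule.sub_mem _ (h2 m) (hstab _ hspec)
  rw [add_sub_cancel_left, smul_smul] at h3
  by_contra hne
  refine hmin ((Submodule.smul_mem_iff _ (mul_ne_zero ?_ hne)).1 h3)
  exact_mod_cast m.succ_ne_zero

lemma IsSI.linDer [CharZero k] {b : Basis ι k L} {χ : Module.Dual k L}
    {f : MvPolynomial ι k} (hf : IsSI b χ f) (T : LieDerivation k L L) :
    IsSI b χ (linDer b (T : L →ₗ[k] L) f) := by
  intro a
  by_cases hf0 : f = 0
  · simp [hf0]
  rw [linDer_actDer, hf a, hf (T a), hf.apply_derivation hf0, zero_smul, sub_zero,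
    Derivation.map_smul]

end WeightsAndDerivations

section Jordan

variable {h : Type} [LieRing h] [LieAlgebra k h]

lemma iterate_lie_eq_zero (T : LieDerivation k h h) {s n : Module.End k h}
    (hT : (T : h →ₗ[k] h) = n + s) (hcomm : Commute n s) {α β : k} (m : ℕ) :
    ∀ (a b : ℕ) (x y : h), a + b ≤ m → s x = α • x → s y = β • y →
      (n ^ a) x = 0 → (n ^ b) y = 0 →
      (((T : h →ₗ[k] h) - (α + β) • (1 : Module.End k h)) ^ m) ⁅x, y⁆ = 0 := by
  have hT' : ∀ x, T x = n x + s x := fun x => LinearMap.congr_fun hT x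
  have hc : ∀ x, s (n x) = n (s x) := fun x => (LinearMap.congr_fun hcomm x).symm
  induction m with
  | zero =>
    intro a b x y hab _ _ ha _
    obtain rfl : a = 0 := by omega
    rw [pow_zero, Module.End.one_apply] at ha ⊢
    rw [ha, zero_lie]
  | succ m ih =>
    intro a b x y hab hx hy ha hb
    rcases a with _ | a
    · rw [pow_zero, Module.End.one_apply] at ha
      rw [ha, zero_lie, map_zero]
    rcases b with _ | b
    · rw [pow_zero, Module.End.one_apply] at hb
      rw [hb, lie_zero, map_zero]
    have h1 : ((T : h →ₗ[k] h) - (α + β) • (1 : Module.End k h)) ⁅x, y⁆ =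
        ⁅n x, y⁆ + ⁅x, n y⁆ := by
      have e := T.apply_lie_eq_add x y
      rw [hT' x, hT' y, hx, hy, lie_add, add_lie, lie_smul, smul_lie] at e
      change T ⁅x, y⁆ - (α + β) • ⁅x, y⁆ = _
      rw [e, add_smul]
      abel
    rw [pow_succ, Module.End.mul_apply, h1, map_add,
      ih a (b + 1) (n x) y (by omega) (by rw [hc, hx, map_smul]) hy (by
        rwa [pow_succ, Module.End.mul_apply] at ha) hb,
      ih (a + 1) b x (n y) (by omega) hx (by rw [hc, hy, map_smul]) ha (by
        rwa [pow_succ, Module.End.mul_apply] at hb), add_zero]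

/-- The Jordan decomposition of a derivation. -/
lemma exists_jordan [IsAlgClosed k] [Module.Finite k h] (T : LieDerivation k h h) :
    ∃ s n : LieDerivation k h h, (∀ x, T x = s x + n x) ∧
      Commute (s : Module.End k h) (n : Module.End k h) ∧
      IsNilpotent (n : Module.End k h) ∧
      ⨆ μ, Module.End.eigenspace (s : Module.End k h) μ = ⊤ := by
  obtain ⟨n, hn, s, hs, hnil, hss, hT⟩ :=
    Module.End.exists_isNilpotent_isSemisimple (f := ((T : h →ₗ[k] h) : Module.End k h))
  have hcomm : Commute n s := Algebra.commute_of_mem_adjoin_of_forall_mem_commute hs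
    fun x hx => by
      rw [Set.mem_singleton_iff] at hx
      subst hx
      exact (Algebra.commute_of_mem_adjoin_self hn).symm
  have hTs : Commute ((T : h →ₗ[k] h) : Module.End k h) s := by
    rw [hT]; exact hcomm.add_left (Commute.refl s)
  have htop := hss.iSup_eigenspace_eq_top
  have hder : ∀ x y, s ⁅x, y⁆ = ⁅x, s y⁆ - ⁅y, s x⁆ := by
    intro x y
    have hx : x ∈ ⨆ μ, s.eigenspace μ := htop ▸ Submodule.mem_top
    have hy : y ∈ ⨆ μ, s.eigenspace μ := htop ▸ Submodule.mem_top
    refine Submodule.iSup_induction _ (motive := fun x => s ⁅x, y⁆ = ⁅x, s y⁆ - ⁅y, s x⁆) hx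
      (fun α x hx => ?_) (by simp) (fun a b ha hb => by
        rw [add_lie, map_add, ha, hb, map_add, lie_add, add_lie]; abel)
    refine Submodule.iSup_induction _ (motive := fun y => s ⁅x, y⁆ = ⁅x, s y⁆ - ⁅y, s x⁆) hy
      (fun β y hy => ?_) (by simp) (fun a b ha hb => by
        rw [lie_add, map_add, ha, hb, map_add, lie_add, add_lie]; abel)
    rw [Module.End.mem_eigenspace_iff] at hx hy
    obtain ⟨N, hN⟩ := hnil
    have h1 := iterate_lie_eq_zero T hT hcomm (N + N) N N x y le_rfl hx hy
      (by rw [hN]; rfl) (by rw [hN]; rfl)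
    have h2 := Module.End.apply_eq_of_mem_of_comm_of_isFinitelySemisimple_of_isNil
      (f := ((T : h →ₗ[k] h) : Module.End k h)) (g := s) (μ := α + β) (m := ⁅x, y⁆)
      ((Module.End.mem_maxGenEigenspace _ _ _).2 ⟨_, h1⟩) hTs hss.isFinitelySemisimple
      (by rw [hT, add_sub_cancel_right]; exact ⟨N, hN⟩)
    rw [h2, hx, hy, lie_smul, lie_smul, ← lie_skew y x, add_smul, smul_neg, sub_neg_eq_add,
      add_comm]
  let S : LieDerivation k h h := ⟨s, hder⟩
  refine ⟨S, T - S, fun x => by simp, ?_, ?_, htop⟩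
  · have : ((T - S : LieDerivation k h h) : h →ₗ[k] h) = n := by
      rw [LieDerivation.coe_sub_linearMap, hT]
      exact add_sub_cancel_right _ _
    rw [this]
    exact hcomm.symm
  · have : ((T - S : LieDerivation k h h) : h →ₗ[k] h) = n := by
      rw [LieDerivation.coe_sub_linearMap, hT]
      exact add_sub_cancel_right _ _
    rw [this]
    exact hnil

end Jordan

section Extension

variable {g h : Type} [LieRing g] [LieAlgebra k g] [LieRing h] [LieAlgebra k h] {n : ℕ}

lemma finrank_map_lt {K V W : Type*} [DivisionRing K] [AddCommGroup V]
    [Module K V] [AddCommGroup W] [Module K W] [Module.Finite K V] (f : V →ₗ[K] W)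
    {p : Submodule K V} {x : V} (hx : x ∈ p) (hx0 : x ≠ 0) (hfx : f x = 0) :
    finrank K (p.map f) < finrank K p := by
  have h1 := LinearMap.finrank_range_add_finrank_ker (f.domRestrict p)
  have h2 : 0 < finrank K (LinearMap.ker (f.domRestrict p)) :=
    Module.finrank_pos_iff_exists_ne_zero.2
      ⟨⟨⟨x, hx⟩, hfx⟩, fun h0 => hx0 (congrArg Subtype.val (congrArg Subtype.val h0))⟩
  rw [LinearMap.range_domRestrict] at h1
  omega

/-- A Jordan decomposition of the derivation `D` by derivations. -/
structure IsJordan (D S N : LieDerivation k h h) : Prop where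
  eq : ∀ x, D x = S x + N x
  comm : Commute (S : Module.End k h) (N : Module.End k h)
  nil : IsNilpotent (N : Module.End k h)
  top : ⨆ μ, Module.End.eigenspace (S : Module.End k h) μ = ⊤

lemma isJordan_of_isNilpotent {N : LieDerivation k h h} (hN : IsNilpotent (N : Module.End k h)) :
    IsJordan N 0 N where
  eq x := by simp
  comm := Commute.zero_left _
  nil := hN
  top := by
    refine eq_top_iff.2 fun x _ => Submodule.mem_iSup_of_mem 0 ?_
    rw [Module.End.mem_eigenspace_iff, zero_smul]
    rfl

namespace IsJordan

variable {D S N : LieDerivation k h h} {c : Basis (Fin n) k h}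

lemma linDer_eq (J : IsJordan D S N) (p : MvPolynomial (Fin n) k) :
    linDer c (D : h →ₗ[k] h) p = linDer c (S : h →ₗ[k] h) p + linDer c (N : h →ₗ[k] h) p := by
  have e : (D : h →ₗ[k] h) = (S : h →ₗ[k] h) + (N : h →ₗ[k] h) := LinearMap.ext J.eq
  rw [e, linDer_add]

lemma linDer_comm (J : IsJordan D S N) (p : MvPolynomial (Fin n) k) :
    linDer c (S : h →ₗ[k] h) (linDer c (N : h →ₗ[k] h) p) =
      linDer c (N : h →ₗ[k] h) (linDer c (S : h →ₗ[k] h) p) := by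
  have h1 := Paper.linDer_comm c (S : h →ₗ[k] h) (N : h →ₗ[k] h) p
  have h2 : (S : h →ₗ[k] h) ∘ₗ (N : h →ₗ[k] h) - (N : h →ₗ[k] h) ∘ₗ (S : h →ₗ[k] h) = 0 :=
    sub_eq_zero.2 J.comm
  have h3 : linDer c (0 : h →ₗ[k] h) p = 0 := by
    have := linDer_add c (0 : h →ₗ[k] h) 0 p
    rwa [add_zero, left_eq_add] at this
  rw [h2, h3, sub_eq_zero] at h1
  exact h1

lemma exists_iterate (J : IsJordan D S N) (p : MvPolynomial (Fin n) k) :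
    ∃ m, (linDer c (N : h →ₗ[k] h))^[m] p = 0 :=
  linDer_iterate_eq_zero c J.nil p

lemma linDer_nil_eq_zero (J : IsJordan D S N) {p : MvPolynomial (Fin n) k} {l : k}
    (hp : linDer c (D : h →ₗ[k] h) p = l • p) : linDer c (N : h →ₗ[k] h) p = 0 :=
  nilpotent_part_apply_eq_zero (s := (linDer c (S : h →ₗ[k] h)).toLinearMap)
    (n := (linDer c (N : h →ₗ[k] h)).toLinearMap)
    (iSup_eigenspace_linDer c J.top) (fun x => J.linDer_comm x) (fun x => J.exists_iterate x)
    (by rw [J.linDer_eq] at hp; exact hp)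

/-- The semi-invariants killed by the nilpotent part are sums of eigenvectors of the semisimple
part with the same properties. -/
lemma exists_components [CharZero k] (J : IsJordan D S N) {χ : Module.Dual k h}
    {f : MvPolynomial (Fin n) k} (hf : IsSI c χ f) (hN : linDer c (N : h →ₗ[k] h) f = 0) :
    ∃ (T : Finset k) (m : k → MvPolynomial (Fin n) k), ∑ μ ∈ T, m μ = f ∧ ∀ μ ∈ T,
      IsSI c χ (m μ) ∧ linDer c (N : h →ₗ[k] h) (m μ) = 0 ∧
        linDer c (S : h →ₗ[k] h) (m μ) = μ • m μ := by
  let W : Submodule k (MvPolynomial (Fin n) k) :=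
    { carrier := {f | IsSI c χ f ∧ linDer c (N : h →ₗ[k] h) f = 0}
      add_mem' := fun {x y} hx hy =>
        ⟨fun a => by rw [map_add, hx.1 a, hy.1 a, smul_add], by rw [map_add, hx.2, hy.2, add_zero]⟩
      zero_mem' := ⟨fun a => by rw [map_zero, smul_zero], map_zero _⟩
      smul_mem' := fun l x hx =>
        ⟨fun a => by rw [Derivation.map_smul, hx.1 a, smul_comm],
          by rw [Derivation.map_smul, hx.2, smul_zero]⟩ }
  obtain ⟨T, m, hm, hsum⟩ := exists_eigen_components (iSup_eigenspace_linDer c J.top) f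
  refine ⟨T, m, hsum, fun μ hμ => ?_⟩
  have h1 := eigen_components_mem (linDer c (S : h →ₗ[k] h)).toLinearMap W
    (fun x hx => ⟨hx.1.linDer S, by
      change linDer c (N : h →ₗ[k] h) (linDer c (S : h →ₗ[k] h) x) = 0
      rw [← J.linDer_comm, hx.2, map_zero]⟩) T m (fun μ _ => hm μ)
    (by rw [hsum]; exact ⟨hf, hN⟩) μ hμ
  exact ⟨h1.1, h1.2, hm μ⟩

end IsJordan

lemma IsSI.linDer_iterate [CharZero k] {c : Basis (Fin n) k h} {χ : Module.Dual k h}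
    {f : MvPolynomial (Fin n) k} (hf : IsSI c χ f) (T : LieDerivation k h h) (m : ℕ) :
    IsSI c χ ((Paper.linDer c (T : h →ₗ[k] h))^[m] f) := by
  induction m with
  | zero => exact hf
  | succ m ih => rw [Function.iterate_succ_apply']; exact ih.linDer T

/-- The algebra generated by the semi-invariants killed by the derivation `N`. -/
noncomputable def killedSemiCenter (c : Basis (Fin n) k h) (N : LieDerivation k h h) :
    Subalgebra k (MvPolynomial (Fin n) k) :=
  Algebra.adjoin k {f | f ∈ semiInvSet c (id : h → h) ∧ linDer c (N : h →ₗ[k] h) f = 0}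

namespace IsExtension

variable {c : Basis (Fin n) k h} {B : Basis (Fin (n + 1)) k g} {φ : h →ₗ⁅k⁆ g}
  {D S N : LieDerivation k h h}

lemma isSI_of_succIncl (H : IsExtension c B φ D) {ξ : Module.Dual k g}
    {f : MvPolynomial (Fin n) k} (hf : IsSI B ξ (succIncl k n f)) :
    IsSI c (ξ ∘ₗ (φ : h →ₗ[k] g)) f ∧ linDer c (D : h →ₗ[k] h) f = ξ (B 0) • f := by
  refine ⟨fun a => succIncl_injective ?_, succIncl_injective ?_⟩
  · rw [← H.actDer_succIncl, hf, map_smul]; rfl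
  · rw [← H.actDer_zero_succIncl, hf, map_smul]

lemma isSI_succIncl (H : IsExtension c B φ D) {ξ : Module.Dual k g}
    {f : MvPolynomial (Fin n) k} (hf : IsSI c (ξ ∘ₗ (φ : h →ₗ[k] g)) f)
    (hD : linDer c (D : h →ₗ[k] h) f = ξ (B 0) • f) : IsSI B ξ (succIncl k n f) := by
  intro v
  obtain ⟨a, ha⟩ := H.exists_decomp v
  have h1 : actDer B v (succIncl k n f) =
      B.repr v 0 • actDer B (B 0) (succIncl k n f) + actDer B (φ a) (succIncl k n f) := by
    conv_lhs => rw [ha]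
    rw [actDer_eq_linDer, map_add, linDer_add, map_smul, ← actDer_eq_linDer B (φ a)]
    congr 1
    have : linDer B (B.repr v 0 • (LieAlgebra.ad k g (B 0) : g →ₗ[k] g)) =
        B.repr v 0 • actDer B (B 0) := derivation_ext fun i => by
      rw [Derivation.smul_apply, actDer_eq_linDer, ← rep_basis B, linDer_rep, linDer_rep,
        LinearMap.smul_apply, ← repₗ_apply, map_smul, repₗ_apply]
    rw [this, Derivation.smul_apply]
  rw [h1, H.actDer_succIncl, H.actDer_zero_succIncl, hf a, hD, map_smul, map_smul]
  conv_rhs => rw [ha]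
  rw [map_add, map_smul, add_smul, smul_smul, smul_eq_mul]
  rfl

lemma exists_extend (H : IsExtension c B φ D) (χ : Module.Dual k h) (l : k) :
    ∃ ξ : Module.Dual k g, ξ ∘ₗ (φ : h →ₗ[k] g) = χ ∧ ξ (B 0) = l := by
  refine ⟨B.constr k (Fin.cons l fun i => χ (c i)), c.ext fun i => ?_, ?_⟩
  · simp [← H.basis]
  · simp

lemma exists_isSI_succIncl (H : IsExtension c B φ D) (J : IsJordan D S N) {χ : Module.Dual k h}
    {f : MvPolynomial (Fin n) k} {l : k} (hf : IsSI c χ f)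
    (hN : linDer c (N : h →ₗ[k] h) f = 0) (hS : linDer c (S : h →ₗ[k] h) f = l • f) :
    ∃ ξ : Module.Dual k g, ξ ∘ₗ (φ : h →ₗ[k] g) = χ ∧ ξ (B 0) = l ∧
      IsSI B ξ (succIncl k n f) := by
  obtain ⟨ξ, h1, h2⟩ := H.exists_extend χ l
  refine ⟨ξ, h1, h2, H.isSI_succIncl (by rwa [h1]) ?_⟩
  rw [J.linDer_eq, hN, hS, h2, add_zero]

lemma semiCenter_eq_map [CharZero k] (H : IsExtension c B φ D) (J : IsJordan D S N)
    (hr : ∀ f ∈ semiInvSet B (id : g → g), ∃ q, succIncl k n q = f) :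
    semiCenter B (id : g → g) = (killedSemiCenter c N).map (succIncl k n) := by
  apply le_antisymm
  · refine Algebra.adjoin_le ?_
    rintro f hf
    obtain ⟨q, rfl⟩ := hr f hf
    obtain ⟨hf0, ξ, hξ⟩ := hf
    obtain ⟨h1, h2⟩ := H.isSI_of_succIncl hξ
    refine ⟨q, Algebra.subset_adjoin ⟨⟨?_, _, h1⟩, J.linDer_nil_eq_zero h2⟩, rfl⟩
    rintro rfl
    exact hf0 (map_zero _)
  · rw [killedSemiCenter, AlgHom.map_adjoin]
    refine Algebra.adjoin_le ?_
    rintro _ ⟨f, ⟨⟨-, χ, hf⟩, hN⟩, rfl⟩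
    obtain ⟨T, m, rfl, hm⟩ := J.exists_components (c := c) hf hN
    change succIncl k n _ ∈ semiCenter B _
    rw [map_sum]
    refine sum_mem fun μ hμ => ?_
    obtain ⟨h1, h2, h3⟩ := hm μ hμ
    obtain ⟨ξ, -, -, h4⟩ := H.exists_isSI_succIncl J h1 h2 h3
    by_cases h0 : succIncl k n (m μ) = 0
    · rw [h0]; exact zero_mem _
    · exact Algebra.subset_adjoin ⟨h0, ξ, h4⟩

lemma gradedIso_killedSemiCenter [CharZero k] (H : IsExtension c B φ D) (J : IsJordan D S N)
    (hr : ∀ f ∈ semiInvSet B (id : g → g), ∃ q, succIncl k n q = f) :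
    GradedIso (killedSemiCenter c N) (semiCenter B (id : g → g)) := by
  rw [H.semiCenter_eq_map J hr]
  exact gradedIso_map _ _ succIncl_injective fun d p =>
    (IsHomogeneous.rename_isHomogeneous_iff (Fin.succ_injective n)).symm

/-- Every weight of `h` is the restriction of a weight of `g`. -/
lemma weightSpan_le_map [CharZero k] (H : IsExtension c B φ D) (J : IsJordan D S N) :
    weightSpan c ≤ (weightSpan B).map (φ : h →ₗ[k] g).dualMap := by
  rw [weightSpan, Submodule.span_le]
  rintro χ ⟨f, hf0, hf⟩
  classical
  have hex := J.exists_iterate (c := c) f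
  obtain ⟨m, hm⟩ : ∃ m, Nat.find hex = m + 1 := by
    refine Nat.exists_eq_succ_of_ne_zero fun h0 => hf0 ?_
    have := Nat.find_spec hex
    rwa [h0] at this
  have hspec := Nat.find_spec hex
  rw [hm, Function.iterate_succ_apply'] at hspec
  have hne : (linDer c (N : h →ₗ[k] h))^[m] f ≠ 0 := Nat.find_min hex (by omega)
  obtain ⟨T, u, hsum, hu⟩ := J.exists_components (hf.linDer_iterate N m) hspec
  obtain ⟨μ, hμ, hμ0⟩ := Finset.exists_ne_zero_of_sum_ne_zero (hsum ▸ hne)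
  obtain ⟨h1, h2, h3⟩ := hu μ hμ
  obtain ⟨ξ, h4, -, h5⟩ := H.exists_isSI_succIncl J h1 h2 h3
  exact ⟨ξ, Submodule.subset_span ⟨_, (map_ne_zero_iff _ succIncl_injective).2 hμ0, h5⟩, h4⟩

lemma finrank_weightSpan_lt [CharZero k] (H : IsExtension c B φ D) (J : IsJordan D S N)
    {χ : Module.Dual k g} (hχ : χ ∈ weightSpan B) (hχ0 : χ ≠ 0)
    (hχφ : χ ∘ₗ (φ : h →ₗ[k] g) = 0) :
    finrank k (weightSpan c) < finrank k (weightSpan B) := by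
  have : Module.Finite k g := Module.Finite.of_basis B
  have : Module.Finite k h := Module.Finite.of_basis c
  exact (Submodule.finrank_mono (H.weightSpan_le_map J)).trans_lt (finrank_map_lt _ hχ hχ0 hχφ)

lemma pderiv_zero_succIncl (p : MvPolynomial (Fin n) k) : pderiv 0 (succIncl k n p) = 0 := by
  refine (algHom_derivation (succIncl k n) 0 (pderiv 0) (fun i => ?_) p).trans (map_zero _)
  rw [rename_X, pderiv_X_of_ne (Fin.succ_ne_zero i), Derivation.zero_apply, map_zero]

lemma exists_succIncl_of_weight [CharZero k] (H : IsExtension c B φ D) {χ : Module.Dual k g}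
    {f₀ : MvPolynomial (Fin (n + 1)) k} (hf₀ : IsSI B χ f₀) (hne : f₀ ≠ 0) (hχ0 : χ ≠ 0)
    (hχφ : χ ∘ₗ (φ : h →ₗ[k] g) = 0) :
    ∀ f ∈ semiInvSet B (id : g → g), ∃ q, succIncl k n q = f := by
  rintro f ⟨-, ξ, hf⟩
  refine mem_range_succIncl ?_
  have h1 := dirDer_eq_zero B hf₀ hf hne
  have h2 : ∀ i : Fin n, χ (B i.succ) = 0 := fun i => by
    rw [H.basis]; exact LinearMap.congr_fun hχφ (c i)
  have h3 : χ (B 0) ≠ 0 := fun h3 => hχ0 (B.ext fun i => by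
    refine Fin.cases ?_ (fun i => ?_) i
    · exact h3
    · exact h2 i)
  rw [dirDer, mkDerivation_eq_sum, Fin.sum_univ_succ, Finset.sum_eq_zero (fun i _ => by
    rw [h2, C_0, mul_zero]), add_zero] at h1
  exact (mul_eq_zero.1 h1).resolve_right fun h0 => h3 (C_eq_zero.1 h0)

/-- In an extension by a nilpotent derivation which does not kill all semi-invariants, all
semi-invariants live on the ideal. -/
lemma exists_succIncl_of_nilpotent [CharZero k] (H : IsExtension c B φ N)
    {μ : Module.Dual k h} {u : MvPolynomial (Fin n) k}
    (hu : IsSI c μ u) (hne : linDer c (N : h →ₗ[k] h) u ≠ 0)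
    (hk : linDer c (N : h →ₗ[k] h) (linDer c (N : h →ₗ[k] h) u) = 0) :
    ∀ f ∈ semiInvSet B (id : g → g), ∃ q, succIncl k n q = f := by
  rintro f ⟨hf0, ξ, hf⟩
  refine mem_range_succIncl ?_
  set w := linDer c (N : h →ₗ[k] h) u with hw
  have hwne : succIncl k n w ≠ 0 := (map_ne_zero_iff _ succIncl_injective).2 hne
  obtain ⟨μ', hμ', hμ0⟩ := H.exists_extend μ 0
  have hwSI : IsSI B μ' (succIncl k n w) := H.isSI_succIncl (by rw [hμ']; exact hu.linDer N)
    (by rw [hk, hμ0, zero_smul])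
  have h1 := sum_pderiv_mul_actDer_of_isSI B (succIncl k n u) hf
  have h2 : ∑ i, pderiv i f * actDer B (B i) (succIncl k n u) =
      pderiv 0 f * succIncl k n w + dirDer B μ' f * succIncl k n u := by
    rw [dirDer, mkDerivation_eq_sum, Fin.sum_univ_succ, Fin.sum_univ_succ, hμ0, C_0, mul_zero,
      zero_add, Finset.sum_mul, H.actDer_zero_succIncl]
    congr 1
    refine Finset.sum_congr rfl fun i _ => ?_
    rw [H.basis, H.actDer_succIncl, hu, map_smul, smul_eq_C_mul, ← hμ', LinearMap.comp_apply]
    simp only [LieHom.coe_toLinearMap]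
    ring
  rw [sum_pderiv_mul_actDer, h2, dirDer_eq_zero B hwSI hf hwne, zero_mul, add_zero,
    H.dirDer_succIncl] at h1
  have h3 : succIncl k n w * pderiv 0 f =
      -succIncl k n (dirDer c (ξ ∘ₗ (φ : h →ₗ[k] g)) u) * f := by
    rw [neg_mul, ← h1, neg_neg, mul_comm]
  have h4 := eq_zero_of_mul_derivation_eq (pderiv (0 : Fin (n + 1))) hf0 (pderiv_zero_succIncl w)
    (by rw [map_neg, pderiv_zero_succIncl, neg_zero]) h3
    (exists_iterate_eq_zero _ (fun i => ⟨2, by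
      classical
      simp [pderiv_X, Pi.single_apply, apply_ite]⟩) f)
  rw [h4, zero_mul] at h3
  exact (mul_eq_zero.1 h3).resolve_left hwne

lemma finrank_weightSpan_le_of_nilpotent [CharZero k] (H : IsExtension c B φ N)
    (hN : IsNilpotent (N : Module.End k h))
    (hr : ∀ f ∈ semiInvSet B (id : g → g), ∃ q, succIncl k n q = f) :
    finrank k (weightSpan B) ≤ finrank k (weightSpan c) := by
  have : Module.Finite k g := Module.Finite.of_basis B
  have : Module.Finite k h := Module.Finite.of_basis c
  let p : g →ₗ[k] h := B.constr k (Fin.cons 0 c)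
  have hp0 : p (B 0) = 0 := by simp [p]
  have hps : ∀ i : Fin n, p (B i.succ) = c i := fun i => by simp [p]
  have hle : weightSpan B ≤ (weightSpan c).map p.dualMap := by
    rw [weightSpan, Submodule.span_le]
    rintro ξ ⟨f, hf0, hf⟩
    obtain ⟨q, rfl⟩ := hr f ⟨hf0, ξ, hf⟩
    obtain ⟨h1, h2⟩ := H.isSI_of_succIncl hf
    have hq0 : q ≠ 0 := by
      rintro rfl
      exact hf0 (map_zero _)
    refine ⟨ξ ∘ₗ (φ : h →ₗ[k] g), Submodule.subset_span ⟨q, hq0, h1⟩, B.ext fun i => ?_⟩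
    rw [LinearMap.dualMap_apply, LinearMap.comp_apply]
    refine Fin.cases ?_ (fun i => ?_) i
    · rw [hp0, map_zero, map_zero]
      have h3 : linDer c (N : h →ₗ[k] h) q = 0 :=
        apply_eq_zero_of_iterate (n := (linDer c (N : h →ₗ[k] h)).toLinearMap) h2
          (linDer_iterate_eq_zero c hN q)
      rw [h3] at h2
      exact ((smul_eq_zero.1 h2.symm).resolve_right hq0).symm
    · rw [hps, H.basis]; rfl
  exact (Submodule.finrank_mono hle).trans (Submodule.finrank_map_le _ _)

end IsExtension

end Extension

section Reduction

/-- The kernel of a character is an ideal of codimension one, of which the Lie algebra is an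
extension. -/
lemma exists_isExtension_of_character [Module.Finite k L] {χ : Module.Dual k L}
    (hχ : ∀ x y : L, χ ⁅x, y⁆ = 0) (hχ0 : χ ≠ 0) :
    ∃ (h : Type) (_ : LieRing h) (_ : LieAlgebra k h) (n : ℕ) (c : Basis (Fin n) k h)
      (B : Basis (Fin (n + 1)) k L) (φ : h →ₗ⁅k⁆ L) (D : LieDerivation k h h),
      IsExtension c B φ D ∧ χ ∘ₗ (φ : h →ₗ[k] L) = 0 := by
  obtain ⟨v, hv⟩ : ∃ v, χ v ≠ 0 := by
    by_contra! h
    exact hχ0 (LinearMap.ext h)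
  let K : LieSubalgebra k L := { LinearMap.ker χ with lie_mem' := fun {x y} _ _ => hχ x y }
  let c : Basis (Fin (finrank k K.toSubmodule)) k K.toSubmodule := Module.finBasis k _
  let B : Basis (Fin (finrank k K.toSubmodule + 1)) k L := Basis.mkFinCons v c
    (fun a x hx ha => by
      have h1 := congrArg χ ha
      rw [map_add, map_smul, show χ x = 0 from hx, add_zero, map_zero, smul_eq_mul] at h1
      exact (mul_eq_zero.1 h1).resolve_right hv)
    (fun z => ⟨-(χ z / χ v), by
      change χ _ = 0
      rw [map_add, map_smul, smul_eq_mul, neg_mul, div_mul_cancel₀ _ hv, add_neg_cancel]⟩)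
  have hB : (B : Fin (finrank k K.toSubmodule + 1) → L) = Fin.cons v ((↑) ∘ c) :=
    Basis.coe_mkFinCons _ _ _ _
  let D : LieDerivation k K K :=
    { toFun := fun x => ⟨⁅v, (x : L)⁆, hχ _ _⟩
      map_add' := fun x y => Subtype.ext (lie_add _ _ _)
      map_smul' := fun a x => Subtype.ext (lie_smul _ _ _)
      leibniz' := fun x y => Subtype.ext (by
        change ⁅v, ⁅(x : L), (y : L)⁆⁆ = ⁅(x : L), ⁅v, (y : L)⁆⁆ - ⁅(y : L), ⁅v, (x : L)⁆⁆
        rw [leibniz_lie, ← lie_skew (y : L)]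
        abel) }
  refine ⟨K, inferInstance, inferInstance, _, c, B, K.incl, D, ⟨fun i => ?_, fun w => ?_⟩, ?_⟩
  · rw [hB]; rfl
  · rw [hB]; rfl
  · exact LinearMap.ext fun x => x.2

/-- Every derivation defines an extension by a one-dimensional algebra. -/
lemma exists_isExtension_of_lieDerivation {h : Type} [LieRing h] [LieAlgebra k h] {n : ℕ}
    (c : Basis (Fin n) k h) (N : LieDerivation k h h) :
    ∃ (g : Type) (_ : LieRing g) (_ : LieAlgebra k g) (B : Basis (Fin (n + 1)) k g)
      (φ : h →ₗ⁅k⁆ g), IsExtension c B φ N := by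
  let : LieRing k := LieRing.ofAssociativeRing
  let : LieAlgebra k k := LieAlgebra.ofAssociativeAlgebra
  let ψ : k →ₗ⁅k⁆ LieDerivation k h h :=
    { toFun := fun t => t • N
      map_add' := fun x y => add_smul x y N
      map_smul' := fun x y => mul_smul x y N
      map_lie' := fun {x y} => by
        refine LieDerivation.ext fun z => ?_
        rw [show ⁅x, y⁆ = 0 from sub_eq_zero.2 (mul_comm x y), LieDerivation.commutator_apply]
        simp [smul_comm x y] }
  let B : Basis (Fin (n + 1)) k (LieAlgebra.SemiDirectSum h k ψ) :=
    ((c.prod (Basis.singleton PUnit.{1} k)).map (LieAlgebra.SemiDirectSum.toProdl ψ).symm).reindex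
      ((finSuccEquiv n).trans (Equiv.optionEquivSumPUnit (Fin n))).symm
  have hB : ∀ i, B (Fin.succ i) = LieAlgebra.SemiDirectSum.inl ψ (c i) := fun i => by
    simp [B]; rfl
  have hB0 : B 0 = LieAlgebra.SemiDirectSum.inr ψ 1 := by
    simp [B]; rfl
  refine ⟨_, inferInstance, inferInstance, B, LieAlgebra.SemiDirectSum.inl ψ, hB, fun w => ?_⟩
  rw [hB0]
  simp [ψ]

/-- A Lie algebra with a proper semi-invariant can be replaced by one with fewer weights, with the
same semi-center and the same sum of dimension and index. -/
lemma exists_finrank_weightSpan_lt [IsAlgClosed k] [CharZero k] {ι : Type} [Fintype ι]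
    (b : Basis ι k L) (hb : weightSpan b ≠ ⊥) :
    ∃ (M : Type) (_ : LieRing M) (_ : LieAlgebra k M) (m : ℕ) (B : Basis (Fin m) k M),
      finrank k (weightSpan B) < finrank k (weightSpan b) ∧
      GradedIso (semiCenter b (id : L → L)) (semiCenter B (id : M → M)) ∧
      finrank k M + lieIndex k M = finrank k L + lieIndex k L := by
  have : Module.Finite k L := Module.Finite.of_basis b
  obtain ⟨χ, f, hf0, hf, hχ0⟩ : ∃ χ f, f ≠ 0 ∧ IsSI b χ f ∧ χ ≠ 0 := by
    by_contra! H
    refine hb ((Submodule.span_eq_bot).2 ?_)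
    rintro χ ⟨f, hf0, hf⟩
    exact H χ f hf0 hf
  obtain ⟨h, _, _, n, c, B, φ, D, H, hχφ⟩ := exists_isExtension_of_character
    (fun x y => hf.apply_lie hf0 x y) hχ0
  have : Module.Finite k h := Module.Finite.of_basis c
  have hfB := hf.changeBasis B
  have hfB0 := (map_ne_zero_iff _ (changeBasis_injective b B)).2 hf0
  obtain ⟨S, N, hDSN, hcomm, hnil, htop⟩ := exists_jordan D
  have J : IsJordan D S N := ⟨hDSN, hcomm, hnil, htop⟩
  have hr := H.exists_succIncl_of_weight hfB hfB0 hχ0 hχφ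
  have hlt : finrank k (weightSpan c) < finrank k (weightSpan b) := by
    rw [weightSpan_eq_of_bases b B]
    exact H.finrank_weightSpan_lt J (Submodule.subset_span ⟨_, hfB0, hfB⟩) hχ0 hχφ
  have hiso : GradedIso (semiCenter b (id : L → L)) (killedSemiCenter c N) :=
    (gradedIso_semiCenter_of_bases b B).trans (H.gradedIso_killedSemiCenter J hr).symm
  have hidx : lieIndex k L + 1 = lieIndex k h := by
    obtain ⟨F, hF⟩ := hr _ ⟨hfB0, χ, hfB⟩
    rw [← hF] at hfB hfB0
    obtain ⟨h1, h2⟩ := H.isSI_of_succIncl hfB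
    rw [hχφ] at h1
    refine H.lieIndex_add_one h1 (isSI_one c) ?_
    have hχB : χ (B 0) ≠ 0 := fun h3 => hχ0 (B.ext fun i => by
      refine Fin.cases ?_ (fun i => ?_) i
      · exact h3
      · rw [H.basis]; exact LinearMap.congr_fun hχφ (c i))
    rw [Derivation.map_one_eq_zero, mul_zero, sub_zero, one_mul, h2]
    exact smul_ne_zero hχB fun h4 => hfB0 (by rw [h4, map_zero])
  have hdim := IsExtension.finrank_eq c B
  by_cases hk : ∀ f ∈ semiInvSet c (id : h → h), linDer c (N : h →ₗ[k] h) f = 0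
  · refine ⟨h, _, _, n, c, hlt, ?_, by omega⟩
    have : killedSemiCenter c N = semiCenter c (id : h → h) :=
      congrArg (Algebra.adjoin k) (Set.ext fun f => and_iff_left_of_imp (hk f))
    rwa [← this]
  · push Not at hk
    obtain ⟨F, ⟨-, μ, hF : IsSI c μ F⟩, hFN⟩ := hk
    classical
    have hex := J.exists_iterate (c := c) F
    obtain ⟨m, hm⟩ : ∃ m, Nat.find hex = m + 2 := by
      have h0 : Nat.find hex ≠ 0 := fun h0 => hFN (by
        have := Nat.find_spec hex
        rw [h0] at this
        rw [show F = 0 from this, map_zero])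
      have h1 : Nat.find hex ≠ 1 := fun h0 => hFN (by
        have := Nat.find_spec hex
        rwa [h0] at this)
      exact ⟨Nat.find hex - 2, by omega⟩
    have hspec := Nat.find_spec hex
    have hmin := Nat.find_min hex (m := m + 1) (by omega)
    rw [hm, Function.iterate_succ_apply', Function.iterate_succ_apply'] at hspec
    rw [Function.iterate_succ_apply'] at hmin
    have hu := hF.linDer_iterate N m
    obtain ⟨g, _, _, B', φ', H'⟩ := exists_isExtension_of_lieDerivation c N
    have hr' := H'.exists_succIncl_of_nilpotent hu hmin hspec
    have hidx' : lieIndex k g + 1 = lieIndex k h :=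
      H'.lieIndex_add_one hu (hu.linDer N) (by
        rw [hspec, mul_zero, sub_zero]; exact mul_ne_zero hmin hmin)
    have hdim' := IsExtension.finrank_eq c B'
    exact ⟨g, _, _, n + 1, B', (H'.finrank_weightSpan_le_of_nilpotent hnil hr').trans_lt hlt,
      hiso.trans (H'.gradedIso_killedSemiCenter (isJordan_of_isNilpotent hnil) hr'), by omega⟩

lemma exists_weightSpan_eq_bot [IsAlgClosed k] [CharZero k] {ι : Type} [Fintype ι]
    (b : Basis ι k L) :
    ∃ (M : Type) (_ : LieRing M) (_ : LieAlgebra k M) (m : ℕ) (B : Basis (Fin m) k M),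
      weightSpan B = ⊥ ∧ GradedIso (semiCenter b (id : L → L)) (semiCenter B (id : M → M)) ∧
      finrank k M + lieIndex k M = finrank k L + lieIndex k L := by
  induction hd : finrank k (weightSpan b) using Nat.strong_induction_on generalizing L ι with
  | _ d ih =>
    by_cases hb : weightSpan b = ⊥
    · have : Module.Finite k L := Module.Finite.of_basis b
      exact ⟨L, _, _, _, Module.finBasis k L, by rw [← weightSpan_eq_of_bases b, hb],
        gradedIso_semiCenter_of_bases b _, rfl⟩
    · obtain ⟨M, _, _, m, B, h1, h2, h3⟩ := exists_finrank_weightSpan_lt b hb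
      obtain ⟨M', i1, i2, m', B', h4, h5, h6⟩ := ih _ (hd ▸ h1) B rfl
      exact ⟨M', i1, i2, m', B', h4, h2.trans h5, h6.trans h3⟩

end Reduction

/-- For any finite-dimensional Lie algebra `𝔤` there is a
finite-dimensional Lie algebra `𝔤'` with no proper semi-invariants
(`(S𝔤')^𝔤'_si = (S𝔤')^𝔤'`), whose Poisson semi-center is isomorphic to that of `𝔤`
as a graded `k`-algebra, and with `c(𝔤') = c(𝔤)`. -/
theorem statement9 {k : Type} [Field k] [IsAlgClosed k] [CharZero k]
    {L : Type} [LieRing L] [LieAlgebra k L]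
    {ι : Type} [Fintype ι] [DecidableEq ι] (b : Basis ι k L) :
    ∃ M : FDLieModel k,
      (semiCenter M.basis (id : M.carrier → M.carrier) =
        invariantsOf (fun v : M.carrier => actDer M.basis v)) ∧
      (∃ e : semiCenter b (id : L → L) ≃ₐ[k]
          semiCenter M.basis (id : M.carrier → M.carrier),
        (∀ (n : ℕ) (x : semiCenter b (id : L → L)),
          MvPolynomial.IsHomogeneous (x : MvPolynomial ι k) n →
            MvPolynomial.IsHomogeneous ((e x : MvPolynomial M.ind k)) n) ∧
        (∀ (n : ℕ) (y : semiCenter M.basis (id : M.carrier → M.carrier)),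
          MvPolynomial.IsHomogeneous (y : MvPolynomial M.ind k) n →
            MvPolynomial.IsHomogeneous ((e.symm y : MvPolynomial ι k)) n)) ∧
      finrank k M.carrier + lieIndex k M.carrier = finrank k L + lieIndex k L := by
  obtain ⟨M, _, _, m, B, h1, ⟨e, he⟩, h3⟩ := exists_weightSpan_eq_bot b
  exact ⟨⟨M, Fin m, B⟩, semiCenter_eq_invariantsOf B h1, ⟨e, fun n x => (he n x).1, fun n y hy =>
    (he n _).2 (by rwa [AlgEquiv.apply_symm_apply])⟩, h3⟩

end Paper
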